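/- Pointwise Hermite interpolation estimate: Under the hypotheses of the strengthened Whitney theorem (r ∈ ℕ₀, m ≥ r+2, x_{j+r+1} - x_j ≥ λ|I| for 0 ≤ j ≤ m-r-2, f ∈ C^{(r)}(I)), for each x ∈ I let σ be a permutation ordering the knots by increasing distance from x (|x - x_{σ_{ν-1}}| ≤ |x - x_{σ_ν}|), and D_r(x,X) = Π_{ν=0}^r |x - x_{σ_ν}|. Then |f(x) - L_{m-1}(x; f; x_0,...,x_{m-1})| ≤ C(m,λ) · D_r(x,X) · ∫_{|x - x_{σ_r}|}^{2|I|} ω_{m-r}(f^{(r)}, t; I)/t² dt. -/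

import Mathlib

open scoped BigOperators

open Classical in
/-- Divided difference with possibly repeated knots, via derivative data `F`
(`F j` is the `j`-th derivative). -/
noncomputable def divDiff (F : ℕ → ℝ → ℝ) : List ℝ → ℝ
  | [] => 0
  | [x] => F 0 x
  | x :: y :: l =>
      if h : ∀ z ∈ y :: l, z = x then
        F ((y :: l).length) x / Nat.factorial ((y :: l).length)
      else
        (divDiff F (y :: l) -
          divDiff F (x :: (y :: l).eraseIdx ((y :: l).findIdx (fun z => z ≠ x)))) /
          ((y :: l).getD ((y :: l).findIdx (fun z => z ≠ x)) 0 - x)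
termination_by l => l.length
decreasing_by
  · simp
  · push_neg at h
    obtain ⟨z, hz, hzx⟩ := h
    have hlt : (y :: l).findIdx (fun z => decide (z ≠ x)) < (y :: l).length :=
      List.findIdx_lt_length_of_exists ⟨z, hz, by simpa using hzx⟩
    simp only [List.length_cons, List.length_eraseIdx] at *
    rw [if_pos hlt]; omega

/-- Newton form of the Hermite interpolation polynomial at the knots `xs`. -/
noncomputable def newtonSum (F : ℕ → ℝ → ℝ) (xs : List ℝ) (t : ℝ) : ℝ :=
  ∑ j ∈ Finset.range xs.length,
    divDiff F (xs.take (j + 1)) * ∏ i ∈ Finset.range j, (t - xs.getD i 0)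

/-- The `k`-th symmetric difference of `g`, set to `0` when the relevant points
leave `[a,b]`. -/
noncomputable def kSymmDiff (k : ℕ) (g : ℝ → ℝ) (u x a b : ℝ) : ℝ :=
  if a ≤ x - (k / 2 : ℝ) * u ∧ x + (k / 2 : ℝ) * u ≤ b then
    ∑ i ∈ Finset.range (k + 1), (-1 : ℝ) ^ i * (k.choose i) * g (x + ((k : ℝ) / 2 - i) * u)
  else 0

/-- The `k`-th modulus of smoothness of `g` on `[a,b]`. -/
noncomputable def smoothOmega (k : ℕ) (g : ℝ → ℝ) (t a b : ℝ) : ℝ :=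
  sSup {v : ℝ | ∃ u x : ℝ, 0 < u ∧ u ≤ t ∧ v = |kSymmDiff k g u x a b|}

/-- First modulus of continuity of `g` on `[a,b]`. -/
noncomputable def omega1 (g : ℝ → ℝ) (t a b : ℝ) : ℝ :=
  sSup {v : ℝ | ∃ x y : ℝ, x ∈ Set.Icc a b ∧ y ∈ Set.Icc a b ∧ |x - y| ≤ t ∧ v = |g x - g y|}

/-- Sup norm on `[a,b]`. -/
noncomputable def supNorm (g : ℝ → ℝ) (a b : ℝ) : ℝ :=
  sSup {v : ℝ | ∃ x ∈ Set.Icc a b, v = |g x|}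

/-- The knots extended by `x₋₁ = x₀ - (xₘ - x₀)` and `x_{m+1} = xₘ + (xₘ - x₀)`. -/
noncomputable def xExt (m : ℕ) (x : ℕ → ℝ) : ℤ → ℝ := fun i =>
  if i < 0 then x 0 - (x m - x 0) else if (m : ℤ) < i then x m + (x m - x 0) else x i.toNat

/-- `d(p,q) = min (x_{q+1} - x_p) (x_q - x_{p-1})`. -/
noncomputable def dpq (m : ℕ) (x : ℕ → ℝ) (p q : ℕ) : ℝ :=
  min (xExt m x ((q : ℤ) + 1) - x p) (x q - xExt m x ((p : ℤ) - 1))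

/-- `Λ_{p,q,r}(x_0,…,x_m; φ)`. -/
noncomputable def Lam (m r : ℕ) (x : ℕ → ℝ) (φ : ℝ → ℝ) (p q : ℕ) : ℝ :=
  (∫ u in Set.Ioc (x q - x p) (dpq m x p q), u ^ ((p : ℤ) + r - q - 1) * φ u) /
    ((∏ i ∈ Finset.range p, (x q - x i)) * ∏ i ∈ Finset.Ioc q m, (x i - x p))

/-- `Λ_r(x_0,…,x_m; φ) = max over admissible (p,q) of Λ_{p,q,r}`. -/
noncomputable def LamMax (m r : ℕ) (x : ℕ → ℝ) (φ : ℝ → ℝ) : ℝ :=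
  sSup {v : ℝ | ∃ p q : ℕ, q ≤ m ∧ p + r + 1 ≤ q ∧ v = Lam m r x φ p q}



/-! ### Moduli of smoothness and forward differences -/

lemma kSymmDiff_eq_fwdDiff {k : ℕ} {g : ℝ → ℝ} {u x a b : ℝ}
    (h : a ≤ x - (k / 2 : ℝ) * u ∧ x + (k / 2 : ℝ) * u ≤ b) :
    kSymmDiff k g u x a b = (fwdDiff u)^[k] g (x - (k / 2 : ℝ) * u) := by
  rw [kSymmDiff, if_pos h, fwdDiff_iter_eq_sum_shift, ← Finset.sum_range_reflect]
  refine Finset.sum_congr rfl fun i hi => ?_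
  have hik : i ≤ k := by simpa [Nat.lt_succ_iff] using hi
  have e : k + 1 - 1 - i = k - i := by omega
  rw [e, Nat.choose_symm hik, zsmul_eq_mul, nsmul_eq_mul, Nat.cast_sub hik]
  push_cast
  congr 2
  ring

lemma abs_fwdDiff_iter_le {g : ℝ → ℝ} {a b M u : ℝ} (hM : ∀ x ∈ Set.Icc a b, |g x| ≤ M)
    (hu : 0 ≤ u) (k : ℕ) {x : ℝ} (hx : a ≤ x) (hxk : x + k * u ≤ b) :
    |(fwdDiff u)^[k] g x| ≤ 2 ^ k * M := by
  induction k generalizing x with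
  | zero => simpa using hM x ⟨hx, by simpa using hxk⟩
  | succ k ih =>
    push_cast at hxk
    rw [Function.iterate_succ_apply', fwdDiff]
    have h1 := ih (x := x + u) (by linarith) (by linarith)
    have h2 := ih (x := x) hx (by linarith)
    calc _ ≤ |(fwdDiff u)^[k] g (x + u)| + |(fwdDiff u)^[k] g x| := abs_sub _ _
      _ ≤ _ := by rw [pow_succ]; linarith

lemma abs_fwdDiff_iter_le_smoothOmega {g : ℝ → ℝ} {a b M u s : ℝ}
    (hM : ∀ x ∈ Set.Icc a b, |g x| ≤ M) (hM0 : 0 ≤ M) (hu : 0 < u) (hus : u ≤ s)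
    {k : ℕ} {x : ℝ} (hx : a ≤ x) (hxk : x + k * u ≤ b) :
    |(fwdDiff u)^[k] g x| ≤ smoothOmega k g s a b := by
  refine le_csSup ⟨2 ^ k * M, ?_⟩ ⟨u, x + (k / 2 : ℝ) * u, hu, hus, ?_⟩
  · rintro v ⟨u', x', hu', -, rfl⟩
    by_cases h : a ≤ x' - (k / 2 : ℝ) * u' ∧ x' + (k / 2 : ℝ) * u' ≤ b
    · rw [kSymmDiff_eq_fwdDiff h]
      exact abs_fwdDiff_iter_le hM hu'.le k h.1 (by linarith [h.2])
    · rw [kSymmDiff, if_neg h]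
      simp only [abs_zero]
      positivity
  · rw [kSymmDiff_eq_fwdDiff ⟨by linarith, by linarith⟩, add_sub_cancel_right]

lemma smoothOmega_le {g : ℝ → ℝ} {a b s w : ℝ} {k : ℕ} (hw : 0 ≤ w)
    (h : ∀ u x, 0 < u → u ≤ s → a ≤ x → x + k * u ≤ b → |(fwdDiff u)^[k] g x| ≤ w) :
    smoothOmega k g s a b ≤ w := by
  refine Real.sSup_le ?_ hw
  rintro v ⟨u, x, hu, hus, rfl⟩
  by_cases hc : a ≤ x - (k / 2 : ℝ) * u ∧ x + (k / 2 : ℝ) * u ≤ b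
  · rw [kSymmDiff_eq_fwdDiff hc]
    exact h u _ hu hus hc.1 (by linarith [hc.2])
  · rw [kSymmDiff, if_neg hc]
    simpa using hw

lemma smoothOmega_nonneg (k : ℕ) (g : ℝ → ℝ) (s a b : ℝ) : 0 ≤ smoothOmega k g s a b := by
  refine Real.sSup_nonneg ?_
  rintro v ⟨u, x, -, -, rfl⟩
  exact abs_nonneg _

lemma smoothOmega_mono {g : ℝ → ℝ} {a b M s s' : ℝ}
    (hM : ∀ x ∈ Set.Icc a b, |g x| ≤ M) (hM0 : 0 ≤ M) (k : ℕ) (hs : s ≤ s') :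
    smoothOmega k g s a b ≤ smoothOmega k g s' a b :=
  smoothOmega_le (smoothOmega_nonneg ..) fun _ _ hu hus hx hxk =>
    abs_fwdDiff_iter_le_smoothOmega hM hM0 hu (hus.trans hs) hx hxk

lemma smoothOmega_le_of_bound {g : ℝ → ℝ} {a b M s : ℝ}
    (hM : ∀ x ∈ Set.Icc a b, |g x| ≤ M) (hM0 : 0 ≤ M) (k : ℕ) :
    smoothOmega k g s a b ≤ 2 ^ k * M :=
  smoothOmega_le (by positivity) fun _ _ hu _ hx hxk => abs_fwdDiff_iter_le hM hu.le k hx hxk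

lemma fwdDiff_iter_polynomial_eq_zero {k : ℕ} {Q : Polynomial ℝ} (hQ : Q.natDegree < k)
    (u x : ℝ) : (fwdDiff u)^[k] (fun y => Q.eval y) x = 0 := by
  have h : ((Q.comp (Polynomial.C u * Polynomial.X + Polynomial.C x)).natDegree) < k := by
    refine lt_of_le_of_lt (Polynomial.natDegree_comp_le.trans ?_) hQ
    calc _ ≤ Q.natDegree * 1 := Nat.mul_le_mul_left _ Polynomial.natDegree_linear_le
      _ = _ := mul_one _
  have h0 := congr_fun (Polynomial.fwdDiff_iter_eq_zero_of_degree_lt h) 0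
  rw [fwdDiff_iter_eq_sum_shift] at h0 ⊢
  rw [← Pi.zero_apply (M := fun _ : ℝ => ℝ) (0 : ℝ), ← h0]
  refine Finset.sum_congr rfl fun i _ => ?_
  simp only [nsmul_eq_mul, mul_one, zero_add, Polynomial.eval_comp, Polynomial.eval_add,
    Polynomial.eval_mul, Polynomial.eval_C, Polynomial.eval_X]
  rw [add_comm x, mul_comm u]

lemma fwdDiff_iter_sub_polynomial {k : ℕ} {Q : Polynomial ℝ} (hQ : Q.natDegree < k)
    (g : ℝ → ℝ) (u x : ℝ) :
    (fwdDiff u)^[k] (fun y => g y - Q.eval y) x = (fwdDiff u)^[k] g x := by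
  have h := fwdDiff_iter_polynomial_eq_zero hQ u x
  rw [fwdDiff_iter_eq_sum_shift] at h ⊢
  rw [fwdDiff_iter_eq_sum_shift]
  simp only [smul_sub, Finset.sum_sub_distrib, h, sub_zero]

lemma smoothOmega_sub_polynomial {k : ℕ} {Q : Polynomial ℝ} (hQ : Q.natDegree < k)
    (g : ℝ → ℝ) (s a b : ℝ) :
    smoothOmega k (fun y => g y - Q.eval y) s a b = smoothOmega k g s a b := by
  unfold smoothOmega
  congr 1
  ext v
  refine exists_congr fun u => exists_congr fun x => and_congr_right fun _ =>
    and_congr_right fun _ => ?_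
  by_cases hc : a ≤ x - (k / 2 : ℝ) * u ∧ x + (k / 2 : ℝ) * u ≤ b
  · rw [kSymmDiff_eq_fwdDiff hc, kSymmDiff_eq_fwdDiff hc, fwdDiff_iter_sub_polynomial hQ]
  · rw [kSymmDiff, kSymmDiff, if_neg hc, if_neg hc]

lemma fwdDiff_two_mul_iter (u : ℝ) (j : ℕ) (g : ℝ → ℝ) (x : ℝ) :
    (fwdDiff (2 * u))^[j] g x =
      ∑ i ∈ Finset.range (j + 1), (j.choose i : ℝ) * (fwdDiff u)^[j] g (x + i * u) := by
  have h2 : fwdDiff_aux.fwdDiffₗ ℝ ℝ (2 * u) =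
      (fwdDiff_aux.shiftₗ ℝ ℝ u + 1) * fwdDiff_aux.fwdDiffₗ ℝ ℝ u := by
    ext f y
    simp only [Module.End.mul_apply, LinearMap.add_apply, Pi.add_apply, Module.End.one_apply,
      fwdDiff_aux.shiftₗ_apply, fwdDiff_aux.coe_fwdDiffₗ, fwdDiff]
    ring_nf
  have hc : Commute (fwdDiff_aux.shiftₗ ℝ ℝ u + 1) (fwdDiff_aux.fwdDiffₗ ℝ ℝ u) := by
    unfold fwdDiff_aux.shiftₗ
    exact ((Commute.refl _).add_left (Commute.one_left _)).add_left (Commute.one_left _)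
  rw [← fwdDiff_aux.coe_fwdDiffₗ_pow, h2, hc.mul_pow, (Commute.one_right _).add_pow]
  simp only [Module.End.mul_apply, LinearMap.sum_apply, Finset.sum_apply, one_pow, mul_one]
  refine Finset.sum_congr rfl fun i _ => ?_
  have : ((j.choose i : ℕ) : Module.End ℤ (ℝ → ℝ)) = (j.choose i) • 1 := by simp
  rw [this, LinearMap.smul_apply, Module.End.one_apply, map_nsmul, Pi.smul_apply,
    fwdDiff_aux.shiftₗ_pow_apply, fwdDiff_aux.coe_fwdDiffₗ_pow, nsmul_eq_mul, nsmul_eq_mul]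

/-! ### Marchaud's inequality -/

lemma abs_sub_le_of_abs_succ_sub_le {v : ℕ → ℝ} {w : ℝ} {j : ℕ} (hw : 0 ≤ w)
    (hv : ∀ i < j, |v (i + 1) - v i| ≤ w) {p q : ℕ} (hp : p ≤ j) (hq : q ≤ j) :
    |v p - v q| ≤ j * w := by
  wlog hpq : q ≤ p generalizing p q
  · rw [abs_sub_comm]
    exact this hq hp (le_of_not_ge hpq)
  have key : ∀ n, q + n ≤ j → |v (q + n) - v q| ≤ n * w := by
    intro n
    induction n with
    | zero => simp
    | succ n ih =>
      intro hn
      have h1 := ih (by omega)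
      have h2 := hv (q + n) (by omega)
      have h3 := abs_sub_le (v (q + (n + 1))) (v (q + n)) (v q)
      rw [← add_assoc] at h3 ⊢
      push_cast
      linarith
  obtain ⟨n, rfl⟩ := Nat.exists_eq_add_of_le hpq
  refine (key n hp).trans ?_
  have : (n : ℝ) ≤ j := by exact_mod_cast (by omega : n ≤ j)
  gcongr

lemma smoothOmega_le_two_mul {g : ℝ → ℝ} {a b M h : ℝ} (hM : ∀ x ∈ Set.Icc a b, |g x| ≤ M)
    (hM0 : 0 ≤ M) {j : ℕ} (hj : 3 * j * h ≤ b - a) :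
    smoothOmega j g h a b ≤
      smoothOmega j g (2 * h) a b / 2 ^ j + j * smoothOmega (j + 1) g h a b := by
  have hw := smoothOmega_nonneg (j + 1) g h a b
  refine smoothOmega_le (add_nonneg (div_nonneg (smoothOmega_nonneg ..) (by positivity))
    (by positivity)) fun u x hu huh hx hxj => ?_
  obtain ⟨x', q, hq, rfl, hx', hxj'⟩ : ∃ (x' : ℝ) (q : ℕ), q ≤ j ∧ x = x' + q * u ∧ a ≤ x' ∧
      x' + 2 * j * u ≤ b := by
    by_cases h1 : x + 2 * j * u ≤ b
    · exact ⟨x, 0, by omega, by simp, hx, h1⟩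
    · refine ⟨x - j * u, j, le_rfl, by ring, ?_, by linarith⟩
      have : (j : ℝ) * u ≤ j * h := by gcongr
      linarith
  set w := smoothOmega (j + 1) g h a b
  set v : ℕ → ℝ := fun i => (fwdDiff u)^[j] g (x' + i * u) with hv
  have hstep : ∀ i < j, |v (i + 1) - v i| ≤ w := by
    intro i hi
    have hij : (i : ℝ) + 1 ≤ j := by exact_mod_cast hi
    have := abs_fwdDiff_iter_le_smoothOmega hM hM0 hu huh (k := j + 1) (x := x' + i * u)
      (by nlinarith [Nat.cast_nonneg (α := ℝ) i]) (by push_cast; nlinarith)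
    rw [Function.iterate_succ_apply', fwdDiff] at this
    simp only [hv]
    push_cast
    rwa [show x' + (i + 1) * u = x' + i * u + u by ring]
  have hsum := fwdDiff_two_mul_iter u j g x'
  have h2 : |(fwdDiff (2 * u))^[j] g x'| ≤ smoothOmega j g (2 * h) a b :=
    abs_fwdDiff_iter_le_smoothOmega hM hM0 (by linarith) (by linarith) hx' (by linarith)
  have hch : ∑ i ∈ Finset.range (j + 1), (j.choose i : ℝ) = 2 ^ j := by
    exact_mod_cast Nat.sum_range_choose j
  have hdiff : |(fwdDiff (2 * u))^[j] g x' - 2 ^ j * v q| ≤ 2 ^ j * (j * w) := by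
    rw [hsum, ← hch, Finset.sum_mul, ← Finset.sum_sub_distrib, Finset.sum_mul]
    refine (Finset.abs_sum_le_sum_abs _ _).trans (Finset.sum_le_sum fun i hi => ?_)
    rw [← mul_sub, abs_mul, Nat.abs_cast]
    gcongr
    exact abs_sub_le_of_abs_succ_sub_le hw hstep
      (by simpa [Nat.lt_succ_iff] using hi) hq
  have h3 : |2 ^ j * v q| ≤ smoothOmega j g (2 * h) a b + 2 ^ j * (j * w) := by
    have := abs_sub_abs_le_abs_sub (2 ^ j * v q) ((fwdDiff (2 * u))^[j] g x')
    rw [abs_sub_comm] at this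
    linarith
  rw [abs_mul, abs_of_pos (by positivity : (0 : ℝ) < 2 ^ j)] at h3
  rw [← mul_le_mul_iff_right₀ (by positivity : (0 : ℝ) < 2 ^ j)]
  refine h3.trans (le_of_eq ?_)
  field_simp

lemma smoothOmega_div_le {g : ℝ → ℝ} {a b M h : ℝ} (hM : ∀ x ∈ Set.Icc a b, |g x| ≤ M)
    (hM0 : 0 ≤ M) {j : ℕ} (hh : 0 < h) (hj : 3 * j * h ≤ b - a) :
    smoothOmega j g h a b / h ≤ 2 / 2 ^ j * (smoothOmega j g (2 * h) a b / (2 * h)) +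
      j * (smoothOmega (j + 1) g h a b / h) := by
  have := smoothOmega_le_two_mul hM hM0 hj
  calc _ ≤ (smoothOmega j g (2 * h) a b / 2 ^ j + j * smoothOmega (j + 1) g h a b) / h := by
        gcongr
    _ = _ := by field_simp

/-- Discrete form of Marchaud's inequality, along dyadic steps. -/
lemma marchaud_dyadic (n : ℕ) : ∃ C : ℝ, 0 < C ∧ ∀ (g : ℝ → ℝ) (a b M d : ℝ) (N : ℕ),
    (∀ x ∈ Set.Icc a b, |g x| ≤ M) → 0 ≤ M → 0 < d →
    (∀ i < N, 3 * (n + 2 : ℕ) * (2 ^ i * d) ≤ b - a) →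
    smoothOmega 1 g d a b / d ≤ C * ((∑ i ∈ Finset.range N,
      smoothOmega (n + 2) g (2 ^ i * d) a b / (2 ^ i * d)) + M / (2 ^ N * d)) := by
  induction n with
  | zero =>
    refine ⟨2, by norm_num, fun g a b M d N hM hM0 hd hN => ?_⟩
    have hT : smoothOmega 1 g (2 ^ N * d) a b / (2 ^ N * d) ≤ 2 * (M / (2 ^ N * d)) := by
      rw [← mul_div_assoc]
      gcongr
      simpa using smoothOmega_le_of_bound hM hM0 1
    have key : ∀ i ≤ N, smoothOmega 1 g d a b / d ≤ (∑ i ∈ Finset.range i,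
        smoothOmega 2 g (2 ^ i * d) a b / (2 ^ i * d)) +
          smoothOmega 1 g (2 ^ i * d) a b / (2 ^ i * d) := by
      intro i
      induction i with
      | zero => simp
      | succ i ih =>
        intro hi
        have h1 := ih (by omega)
        have hNi := hN i (by omega)
        have hp : 0 < 2 ^ i * d := by positivity
        have h2 := smoothOmega_div_le hM hM0 (j := 1) hp
          (by push_cast at hNi ⊢; nlinarith)
        rw [Finset.sum_range_succ, pow_succ]
        norm_num at h2
        rw [show (2 : ℝ) ^ i * 2 * d = 2 * (2 ^ i * d) by ring]
        linarith
    have h := key N le_rfl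
    have hS : 0 ≤ ∑ i ∈ Finset.range N, smoothOmega 2 g (2 ^ i * d) a b / (2 ^ i * d) :=
      Finset.sum_nonneg fun i _ => div_nonneg (smoothOmega_nonneg ..) (by positivity)
    simp only [zero_add]
    linarith
  | succ n ih =>
    obtain ⟨C, hC, H⟩ := ih
    refine ⟨C * (2 ^ (n + 2) + 1 + 2 * (n + 2)), by positivity,
      fun g a b M d N hM hM0 hd hN => ?_⟩
    have hN' : ∀ i < N, 3 * (n + 2 : ℕ) * (2 ^ i * d) ≤ b - a := fun i hi => by
      refine le_trans ?_ (hN i hi)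
      gcongr
      omega
    have h1 := H g a b M d N hM hM0 hd hN'
    rw [mul_assoc]
    refine h1.trans (mul_le_mul_of_nonneg_left ?_ hC.le)
    set T := M / (2 ^ N * d)
    have hT0 : 0 ≤ T := by positivity
    set β : ℕ → ℝ := fun i => smoothOmega (n + 2) g (2 ^ i * d) a b / (2 ^ i * d) with hβ
    set γ : ℕ → ℝ := fun i => smoothOmega (n + 1 + 2) g (2 ^ i * d) a b / (2 ^ i * d) with hγ
    have hβ0 : ∀ i, 0 ≤ β i := fun i => div_nonneg (smoothOmega_nonneg ..) (by positivity)
    have hγ0 : 0 ≤ ∑ i ∈ Finset.range N, γ i :=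
      Finset.sum_nonneg fun i _ => div_nonneg (smoothOmega_nonneg ..) (by positivity)
    have hT : β N ≤ 2 ^ (n + 2) * T := by
      simp only [hβ, T]
      rw [← mul_div_assoc]
      gcongr
      exact smoothOmega_le_of_bound hM hM0 _
    have hs : ∀ i < N, β i ≤ 1 / 2 * β (i + 1) + (n + 2) * γ i := by
      intro i hi
      have hp : 0 < 2 ^ i * d := by positivity
      have h2 := smoothOmega_div_le hM hM0 (j := n + 2) hp (hN' i hi)
      rw [show 2 * (2 ^ i * d) = 2 ^ (i + 1) * d by ring] at h2
      have h3 : (2 : ℝ) / 2 ^ (n + 2) ≤ 1 / 2 := by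
        rw [div_le_div_iff₀ (by positivity) (by norm_num), pow_add]
        have : (1 : ℝ) ≤ 2 ^ n := one_le_pow₀ (by norm_num)
        linarith
      have h4 := mul_le_mul_of_nonneg_right h3 (hβ0 (i + 1))
      simp only [hβ, hγ] at h2 h4 ⊢
      push_cast at h2
      rw [show n + 1 + 2 = n + 2 + 1 by ring]
      linarith
    have hsum := Finset.sum_le_sum fun i hi => hs i (Finset.mem_range.1 hi)
    rw [Finset.sum_add_distrib, ← Finset.mul_sum, ← Finset.mul_sum] at hsum
    have hshift := Finset.sum_range_succ' β N
    rw [Finset.sum_range_succ] at hshift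
    have := hβ0 0
    have e : ∑ i ∈ Finset.range N, smoothOmega (n + 2) g (2 ^ i * d) a b / (2 ^ i * d) =
      ∑ i ∈ Finset.range N, β i := rfl
    have e1 : 0 ≤ (2 : ℝ) ^ (n + 2) * ∑ i ∈ Finset.range N, γ i := by positivity
    have e2 : 0 ≤ (2 * ((n : ℝ) + 2)) * T := by positivity
    nlinarith

/-! ### Whitney's inequality -/

lemma abs_sub_le_smoothOmega_one {g : ℝ → ℝ} {a b M d : ℝ} (hM : ∀ x ∈ Set.Icc a b, |g x| ≤ M)
    (hM0 : 0 ≤ M) {y z : ℝ} (hy : y ∈ Set.Icc a b) (hz : z ∈ Set.Icc a b) (hyz : |y - z| ≤ d) :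
    |g y - g z| ≤ smoothOmega 1 g d a b := by
  wlog h : z ≤ y generalizing y z
  · rw [abs_sub_comm]
    exact this hz hy (by rwa [abs_sub_comm]) (le_of_not_ge h)
  rcases h.eq_or_lt with rfl | h
  · simpa using smoothOmega_nonneg ..
  · have := abs_fwdDiff_iter_le_smoothOmega hM hM0 (u := y - z) (s := d) (k := 1) (x := z)
      (by linarith) ((le_abs_self _).trans hyz) hz.1 (by simpa using hy.2)
    simpa [fwdDiff] using this

lemma exists_dyadic_scale {c d l : ℝ} (hc : 0 < c) (hd : 0 < d) :
    ∃ N : ℕ, (∀ i < N, c * (2 ^ i * d) ≤ l) ∧ l < c * (2 ^ N * d) := by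
  have h : ∃ N : ℕ, l < c * (2 ^ N * d) := by
    obtain ⟨N, hN⟩ := pow_unbounded_of_one_lt (l / (c * d)) (one_lt_two : (1 : ℝ) < 2)
    refine ⟨N, ?_⟩
    rw [div_lt_iff₀ (by positivity)] at hN
    linarith
  classical
  exact ⟨Nat.find h, fun i hi => not_lt.1 (Nat.find_min h hi), Nat.find_spec h⟩

lemma div_le_of_lt_mul {c e l M : ℝ} (hM0 : 0 ≤ M) (hl : 0 < l) (he : 0 < e)
    (h : l < c * e) : M / e ≤ c * (M / l) := by
  rw [← mul_div_assoc, div_le_div_iff₀ he hl]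
  nlinarith

lemma marchaud_crude (n : ℕ) : ∃ C : ℝ, 0 < C ∧ ∀ (g : ℝ → ℝ) (a b M d : ℝ), a < b →
    (∀ x ∈ Set.Icc a b, |g x| ≤ M) → 0 ≤ M → 0 < d →
    smoothOmega 1 g d a b ≤
      C * (smoothOmega (n + 2) g (b - a) a b + d / (b - a) * M) := by
  obtain ⟨C, hC, H⟩ := marchaud_dyadic n
  refine ⟨C * (2 + 3 * (n + 2 : ℕ)), by positivity, fun g a b M d hab hM hM0 hd => ?_⟩
  have hl : 0 < b - a := by linarith
  obtain ⟨N, hN, hN'⟩ := exists_dyadic_scale (c := 3 * (n + 2 : ℕ)) (d := d) (l := b - a)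
    (by positivity) hd
  have h1 := H g a b M d N hM hM0 hd hN
  set w := smoothOmega (n + 2) g (b - a) a b
  have hw : 0 ≤ w := smoothOmega_nonneg ..
  have hsum : ∑ i ∈ Finset.range N, smoothOmega (n + 2) g (2 ^ i * d) a b / (2 ^ i * d) ≤
      2 * (w / d) := by
    calc _ ≤ ∑ i ∈ Finset.range N, (1 / 2 : ℝ) ^ i * (w / d) := by
          refine Finset.sum_le_sum fun i hi => ?_
          have hi' := hN i (Finset.mem_range.1 hi)
          have hp : 0 < 2 ^ i * d := by positivity
          have : smoothOmega (n + 2) g (2 ^ i * d) a b ≤ w := by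
            refine smoothOmega_mono hM hM0 _ (le_trans ?_ hi')
            push_cast
            nlinarith [Nat.cast_nonneg (α := ℝ) n]
          calc _ ≤ w / (2 ^ i * d) := by gcongr
            _ = _ := by rw [one_div, inv_pow]; field_simp
      _ ≤ _ := by
          rw [← Finset.sum_mul]
          gcongr
          rw [geom_sum_eq (by norm_num), div_le_iff_of_neg (by norm_num)]
          have : (0 : ℝ) ≤ (1 / 2) ^ N := by positivity
          linarith
  have hT := div_le_of_lt_mul hM0 hl (by positivity : 0 < 2 ^ N * d) hN'
  rw [div_le_iff₀ hd] at h1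
  refine h1.trans ?_
  rw [mul_assoc, mul_assoc]
  refine mul_le_mul_of_nonneg_left ?_ hC.le
  calc _ ≤ (2 * (w / d) + 3 * (n + 2 : ℕ) * (M / (b - a))) * d := by gcongr
    _ = 2 * w + 3 * (n + 2 : ℕ) * (d / (b - a) * M) := by field_simp
    _ ≤ _ := by
      have : 0 ≤ d / (b - a) * M := by positivity
      have : 0 ≤ (3 * (n + 2 : ℕ) : ℝ) * w := by positivity
      nlinarith

lemma abs_grid_le {e : ℝ → ℝ} {a d w : ℝ} {k L : ℕ} (hk : 0 < k) (hw : 0 ≤ w)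
    (h0 : ∀ i < k, e (a + i * d) = 0)
    (hD : ∀ p, p + k ≤ L → |(fwdDiff d)^[k] e (a + p * d)| ≤ w) :
    ∀ i ≤ L, |e (a + i * d)| ≤ (2 ^ k) ^ i * w := by
  intro i
  induction i using Nat.strong_induction_on with
  | _ i ih =>
  intro hi
  by_cases hik : i < k
  · rw [h0 i hik, abs_zero]
    positivity
  obtain ⟨p, rfl⟩ := Nat.exists_eq_add_of_le' (not_lt.1 hik)
  have h1 := hD p hi
  rw [fwdDiff_iter_eq_sum_shift, Finset.sum_range_succ] at h1
  simp only [Nat.sub_self, pow_zero, Nat.choose_self, Nat.cast_one, mul_one, one_smul,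
    nsmul_eq_mul] at h1
  rw [show a + p * d + k * d = a + (p + k : ℕ) * d by push_cast; ring] at h1
  set S := ∑ x ∈ Finset.range k,
    ((-1 : ℤ) ^ (k - x) * (k.choose x : ℤ)) • e (a + p * d + x * d) with hS
  have hS' : |S| ≤ (2 ^ k - 1) * ((2 ^ k) ^ (p + k - 1) * w) := by
    have hch : ∑ i ∈ Finset.range k, (k.choose i : ℝ) = 2 ^ k - 1 := by
      have : ∑ i ∈ Finset.range (k + 1), (k.choose i : ℝ) = 2 ^ k := by
        exact_mod_cast Nat.sum_range_choose k
      rw [Finset.sum_range_succ, Nat.choose_self] at this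
      push_cast at this
      linarith
    rw [← hch, Finset.sum_mul]
    refine (Finset.abs_sum_le_sum_abs _ _).trans (Finset.sum_le_sum fun l hl => ?_)
    have hl' := Finset.mem_range.1 hl
    rw [zsmul_eq_mul, abs_mul]
    push_cast
    rw [abs_mul, abs_pow, abs_neg, abs_one, one_pow, one_mul, Nat.abs_cast]
    gcongr
    have := ih (p + l) (by omega) (by omega)
    rw [show a + p * d + l * d = a + (p + l : ℕ) * d by push_cast; ring]
    refine this.trans ?_
    gcongr
    · exact one_le_pow₀ (by norm_num)
    · omega
  have h2 : |e (a + (p + k : ℕ) * d)| ≤ w + |S| := by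
    have := abs_sub_abs_le_abs_sub (e (a + (p + k : ℕ) * d)) (-S)
    rw [sub_neg_eq_add, abs_neg, add_comm _ S] at this
    linarith
  have h3 : w ≤ (2 ^ k) ^ (p + k - 1) * w :=
    le_mul_of_one_le_left hw (one_le_pow₀ (one_le_pow₀ (by norm_num)))
  have h4 : ((2 : ℝ) ^ k) ^ (p + k) = 2 ^ k * (2 ^ k) ^ (p + k - 1) := by
    rw [← pow_succ']
    congr 1
    omega
  rw [h4]
  linarith

/-- Whitney's inequality on an interval. -/
theorem whitney (n : ℕ) : ∃ C : ℝ, 0 < C ∧ ∀ (g : ℝ → ℝ) (a b : ℝ), a < b →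
    ContinuousOn g (Set.Icc a b) → ∃ Q : Polynomial ℝ, Q.natDegree < n + 2 ∧
      ∀ x ∈ Set.Icc a b, |g x - Q.eval x| ≤ C * smoothOmega (n + 2) g (b - a) a b := by
  obtain ⟨C, hC, H⟩ := marchaud_crude n
  obtain ⟨L, hL⟩ := exists_nat_ge (2 * C + (n + 2 : ℕ))
  have hL0 : (0 : ℝ) < L := lt_of_lt_of_le (by positivity) hL
  have hLk : n + 2 ≤ L := by
    have : ((n + 2 : ℕ) : ℝ) ≤ L := by linarith
    exact_mod_cast this
  refine ⟨2 * ((2 ^ (n + 2)) ^ L + C), by positivity, fun g a b hab hg => ?_⟩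
  have hl : 0 < b - a := by linarith
  set d := (b - a) / L with hd
  have hd0 : 0 < d := by positivity
  have hLd : L * d = b - a := by rw [hd]; field_simp
  set v : ℕ → ℝ := fun i => a + i * d with hv
  have hinj : Set.InjOn v (Finset.range (n + 2)) := by
    intro i _ j _ hij
    simpa [hv, hd0.ne'] using hij
  set Q := Lagrange.interpolate (Finset.range (n + 2)) v (fun i => g (v i)) with hQ
  have hdeg : Q.natDegree < n + 2 := by
    have := Lagrange.degree_interpolate_lt (fun i => g (v i)) hinj
    rw [Finset.card_range] at this
    by_cases hQ0 : Q = 0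
    · rw [hQ0, Polynomial.natDegree_zero]
      omega
    · rwa [Polynomial.natDegree_lt_iff_degree_lt hQ0]
  refine ⟨Q, hdeg, ?_⟩
  set e : ℝ → ℝ := fun y => g y - Q.eval y with he
  have hec : ContinuousOn e (Set.Icc a b) := hg.sub Q.continuous.continuousOn
  obtain ⟨z, hz, hzmax⟩ := isCompact_Icc.exists_isMaxOn (Set.nonempty_Icc.2 hab.le) hec.abs
  set M := |e z|
  have hM : ∀ x ∈ Set.Icc a b, |e x| ≤ M := fun x hx => hzmax hx
  have hM0 : 0 ≤ M := abs_nonneg _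
  set w := smoothOmega (n + 2) g (b - a) a b with hw
  have hw0 : 0 ≤ w := smoothOmega_nonneg ..
  have hwe : smoothOmega (n + 2) e (b - a) a b = w := smoothOmega_sub_polynomial hdeg g _ a b
  have hgrid := abs_grid_le (e := e) (a := a) (d := d) (w := w) (k := n + 2) (L := L)
    (by omega) hw0
    (fun i hi => by
      have := Lagrange.eval_interpolate_at_node (fun i => g (v i)) hinj (Finset.mem_range.2 hi)
      simp only [he]
      rw [sub_eq_zero]
      exact this.symm)
    (fun p hp => by
      rw [← hwe]
      have hp' : ((p : ℝ) + (n + 2 : ℕ)) * d ≤ L * d := by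
        gcongr
        exact_mod_cast hp
      have hn : ((n + 2 : ℕ) : ℝ) * d ≤ L * d := by gcongr
      have hn1 : 1 * d ≤ ((n + 2 : ℕ) : ℝ) * d := by
        gcongr
        push_cast
        linarith [Nat.cast_nonneg (α := ℝ) n]
      refine abs_fwdDiff_iter_le_smoothOmega hM hM0 hd0 (by linarith) ?_ (by linarith)
      have : 0 ≤ (p : ℝ) * d := by positivity
      linarith)
  obtain ⟨i, hiL, hi⟩ : ∃ i : ℕ, i ≤ L ∧ |z - (a + i * d)| ≤ d := by
    have h0 : 0 ≤ (z - a) / d := div_nonneg (by linarith [hz.1]) hd0.le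
    have h1 := Nat.floor_le h0
    have h2 := Nat.lt_floor_add_one ((z - a) / d)
    refine ⟨⌊(z - a) / d⌋₊, ?_, ?_⟩
    · refine Nat.floor_le_of_le ?_
      rw [div_le_iff₀ hd0, hLd]
      linarith [hz.2]
    · rw [le_div_iff₀ hd0] at h1
      rw [div_lt_iff₀ hd0] at h2
      rw [abs_le]
      constructor <;> nlinarith
  have hnode : a + i * d ∈ Set.Icc a b := by
    have h1 : 0 ≤ (i : ℝ) * d := by positivity
    have h2 : (i : ℝ) * d ≤ L * d := by gcongr
    exact ⟨by linarith, by linarith⟩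
  have h1 := abs_sub_le_smoothOmega_one hM hM0 hz hnode hi
  have h2 := H e a b M d hab hM hM0 hd0
  rw [hwe] at h2
  have h3 : |e (a + i * d)| ≤ (2 ^ (n + 2)) ^ L * w := by
    refine (hgrid i hiL).trans ?_
    gcongr
    exact one_le_pow₀ (by norm_num)
  have h4 : C * (d / (b - a)) ≤ 1 / 2 := by
    rw [hd, div_div, mul_comm (L : ℝ), ← div_div, div_self hl.ne', mul_one_div,
      div_le_div_iff₀ hL0 (by norm_num)]
    have : (0 : ℝ) ≤ (n + 2 : ℕ) := by positivity
    linarith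
  have h5 : M ≤ |e z - e (a + i * d)| + |e (a + i * d)| := by
    have := abs_sub_abs_le_abs_sub (e z) (e (a + i * d))
    linarith
  have h6 := mul_le_mul_of_nonneg_right h4 hM0
  intro x hx
  refine (hM x hx).trans ?_
  linarith

/-! ### Integrals of the modulus of smoothness -/

/-- The weighted integral of the modulus of smoothness over `(d, 2(b-a)]`. -/
noncomputable def omegaIntegral (k : ℕ) (g : ℝ → ℝ) (d a b : ℝ) : ℝ :=
  ∫ s in Set.Ioc d (2 * (b - a)), smoothOmega k g s a b / s ^ 2

lemma omegaIntegral_nonneg (k : ℕ) (g : ℝ → ℝ) (d a b : ℝ) : 0 ≤ omegaIntegral k g d a b :=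
  MeasureTheory.integral_nonneg fun _ => div_nonneg (smoothOmega_nonneg ..) (sq_nonneg _)

lemma integrableOn_smoothOmega {g : ℝ → ℝ} {a b M d : ℝ} (hM : ∀ x ∈ Set.Icc a b, |g x| ≤ M)
    (hM0 : 0 ≤ M) (hd : 0 < d) (k : ℕ) (e : ℝ) :
    MeasureTheory.IntegrableOn (fun s => smoothOmega k g s a b / s ^ 2) (Set.Ioc d e) := by
  have hmono : Monotone fun s => smoothOmega k g s a b :=
    fun _ _ h => smoothOmega_mono hM hM0 k h
  refine MeasureTheory.Measure.integrableOn_of_bounded (M := 2 ^ k * M / d ^ 2)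
    measure_Ioc_lt_top.ne (hmono.measurable.div (measurable_id.pow_const 2)).aestronglyMeasurable ?_
  refine (MeasureTheory.ae_restrict_iff' measurableSet_Ioc).2 (Filter.Eventually.of_forall ?_)
  intro s hs
  have h0 := smoothOmega_nonneg k g s a b
  rw [Real.norm_of_nonneg (by positivity)]
  have h1 := smoothOmega_le_of_bound (s := s) hM hM0 k
  have h2 := hs.1.le
  gcongr

lemma omegaIntegral_anti {g : ℝ → ℝ} {a b M d d' : ℝ} (hM : ∀ x ∈ Set.Icc a b, |g x| ≤ M)
    (hM0 : 0 ≤ M) (hd : 0 < d) (hdd : d ≤ d') (k : ℕ) :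
    omegaIntegral k g d' a b ≤ omegaIntegral k g d a b :=
  MeasureTheory.setIntegral_mono_set (integrableOn_smoothOmega hM hM0 hd k _)
    (Filter.Eventually.of_forall fun _ => div_nonneg (smoothOmega_nonneg ..) (sq_nonneg _))
    (Set.Ioc_subset_Ioc_left hdd).eventuallyLE

lemma smoothOmega_div_le_integral {g : ℝ → ℝ} {a b M h : ℝ}
    (hM : ∀ x ∈ Set.Icc a b, |g x| ≤ M) (hM0 : 0 ≤ M) (hh : 0 < h) (k : ℕ) :
    smoothOmega k g h a b / h ≤
      4 * ∫ s in Set.Ioc h (2 * h), smoothOmega k g s a b / s ^ 2 := by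
  have h1 : ∫ _ in Set.Ioc h (2 * h), smoothOmega k g h a b / (2 * h) ^ 2 ≤
      ∫ s in Set.Ioc h (2 * h), smoothOmega k g s a b / s ^ 2 := by
    refine MeasureTheory.setIntegral_mono_on (by simp) (integrableOn_smoothOmega hM hM0 hh k _)
      measurableSet_Ioc fun s hs => ?_
    have hs0 : 0 < s := hh.trans hs.1
    have := smoothOmega_nonneg k g s a b
    have h3 := smoothOmega_mono hM hM0 k hs.1.le
    have h4 := hs.2
    gcongr
  have e : (2 * h - h) = h := by ring
  rw [MeasureTheory.setIntegral_const, Real.volume_real_Ioc_of_le (by linarith), e] at h1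
  calc _ = 4 * (h • (smoothOmega k g h a b / (2 * h) ^ 2)) := by
        rw [smul_eq_mul]
        field_simp
        norm_num
    _ ≤ _ := by gcongr

lemma sum_smoothOmega_le_integral {g : ℝ → ℝ} {a b M d : ℝ}
    (hM : ∀ x ∈ Set.Icc a b, |g x| ≤ M) (hM0 : 0 ≤ M) (hd : 0 < d) (k N : ℕ) :
    ∑ i ∈ Finset.range N, smoothOmega k g (2 ^ i * d) a b / (2 ^ i * d) ≤
      4 * ∫ s in Set.Ioc d (2 ^ N * d), smoothOmega k g s a b / s ^ 2 := by
  induction N with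
  | zero => simp
  | succ N ih =>
    have hp : 0 < 2 ^ N * d := by positivity
    have h1 := smoothOmega_div_le_integral hM hM0 hp k
    have hle : d ≤ 2 ^ N * d := le_mul_of_one_le_left hd.le (one_le_pow₀ (by norm_num))
    rw [Finset.sum_range_succ, show (2 : ℝ) ^ (N + 1) * d = 2 * (2 ^ N * d) by ring,
      ← Set.Ioc_union_Ioc_eq_Ioc hle (by linarith : 2 ^ N * d ≤ 2 * (2 ^ N * d)),
      MeasureTheory.setIntegral_union (Set.Ioc_disjoint_Ioc_of_le le_rfl) measurableSet_Ioc
        (integrableOn_smoothOmega hM hM0 hd k _) (integrableOn_smoothOmega hM hM0 hp k _)]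
    linarith

lemma smoothOmega_le_omegaIntegral {g : ℝ → ℝ} {a b M d : ℝ}
    (hM : ∀ x ∈ Set.Icc a b, |g x| ≤ M) (hM0 : 0 ≤ M) (hab : a < b) (hd : 0 < d)
    (hdl : d ≤ b - a) (k : ℕ) :
    smoothOmega k g (b - a) a b ≤ 4 * (b - a) * omegaIntegral k g d a b := by
  have hl : 0 < b - a := by linarith
  have h1 := smoothOmega_div_le_integral hM hM0 hl k
  have h2 := omegaIntegral_anti hM hM0 hd hdl k
  rw [omegaIntegral] at h2
  rw [div_le_iff₀ hl] at h1
  nlinarith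

/-- Marchaud's inequality on an interval. -/
theorem marchaud (n : ℕ) : ∃ C : ℝ, 0 < C ∧ ∀ (g : ℝ → ℝ) (a b M d : ℝ), a < b →
    (∀ x ∈ Set.Icc a b, |g x| ≤ M) → 0 ≤ M → 0 < d → d ≤ b - a →
    smoothOmega 1 g d a b ≤ C * d * (omegaIntegral (n + 2) g d a b + M / (b - a)) := by
  obtain ⟨C, hC, H⟩ := marchaud_dyadic n
  refine ⟨C * (4 + 3 * (n + 2 : ℕ)), by positivity, fun g a b M d hab hM hM0 hd hdl => ?_⟩
  have hl : 0 < b - a := by linarith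
  obtain ⟨N, hN, hN'⟩ := exists_dyadic_scale (c := 3 * (n + 2 : ℕ)) (d := d) (l := b - a)
    (by positivity) hd
  have h1 := H g a b M d N hM hM0 hd hN
  have hT := div_le_of_lt_mul hM0 hl (by positivity : 0 < 2 ^ N * d) hN'
  have hS := sum_smoothOmega_le_integral hM hM0 hd (n + 2) N
  have hNl : 2 ^ N * d ≤ 2 * (b - a) := by
    rcases N with _ | N
    · linarith
    · have h3 := hN N (by omega)
      have hp : 0 < 2 ^ N * d := by positivity
      push_cast at h3
      rw [pow_succ]
      nlinarith [Nat.cast_nonneg (α := ℝ) n]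
  have hI : ∫ s in Set.Ioc d (2 ^ N * d), smoothOmega (n + 2) g s a b / s ^ 2 ≤
      omegaIntegral (n + 2) g d a b :=
    MeasureTheory.setIntegral_mono_set (integrableOn_smoothOmega hM hM0 hd _ _)
      (Filter.Eventually.of_forall fun _ => div_nonneg (smoothOmega_nonneg ..) (sq_nonneg _))
      (Set.Ioc_subset_Ioc_right hNl).eventuallyLE
  rw [div_le_iff₀ hd] at h1
  refine h1.trans ?_
  have e : C * (4 + 3 * (n + 2 : ℕ)) * d * (omegaIntegral (n + 2) g d a b + M / (b - a)) =
    C * ((4 + 3 * (n + 2 : ℕ)) * (omegaIntegral (n + 2) g d a b + M / (b - a))) * d := by ring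
  rw [e]
  have h2 : 0 ≤ M / (b - a) := by positivity
  have h3 := omegaIntegral_nonneg (n + 2) g d a b
  have h4 : (0 : ℝ) ≤ (3 * (n + 2 : ℕ) : ℝ) * omegaIntegral (n + 2) g d a b := by positivity
  gcongr
  linarith

/-- Polynomial approximation with simultaneous control of the error and its increments. -/
theorem exists_polynomial_approx (n : ℕ) : ∃ C : ℝ, 0 < C ∧ ∀ (g : ℝ → ℝ) (a b : ℝ), a < b →
    ContinuousOn g (Set.Icc a b) → ∃ Q : Polynomial ℝ, Q.natDegree < n + 2 ∧
      ∀ d, 0 < d → d ≤ b - a →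
        (∀ x ∈ Set.Icc a b,
          |g x - Q.eval x| ≤ C * (b - a) * omegaIntegral (n + 2) g d a b) ∧
        ∀ y ∈ Set.Icc a b, ∀ z ∈ Set.Icc a b, |y - z| ≤ d →
          |(g y - Q.eval y) - (g z - Q.eval z)| ≤ C * d * omegaIntegral (n + 2) g d a b := by
  obtain ⟨C₁, hC₁, H₁⟩ := whitney n
  obtain ⟨C₂, hC₂, H₂⟩ := marchaud n
  refine ⟨max (C₁ * 4) (C₂ * (1 + C₁ * 4)), by positivity, fun g a b hab hg => ?_⟩
  obtain ⟨Q, hQ, hW⟩ := H₁ g a b hab hg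
  refine ⟨Q, hQ, fun d hd hdl => ?_⟩
  have hl : 0 < b - a := by linarith
  obtain ⟨M, hM⟩ := isCompact_Icc.exists_bound_of_continuousOn hg
  simp only [Real.norm_eq_abs] at hM
  have hM0 : 0 ≤ M := (abs_nonneg _).trans (hM a ⟨le_rfl, hab.le⟩)
  have hJ := omegaIntegral_nonneg (n + 2) g d a b
  have hω := smoothOmega_le_omegaIntegral hM hM0 hab hd hdl (n + 2)
  have hω0 := smoothOmega_nonneg (n + 2) g (b - a) a b
  have hsup : ∀ x ∈ Set.Icc a b,
      |g x - Q.eval x| ≤ C₁ * 4 * (b - a) * omegaIntegral (n + 2) g d a b := by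
    intro x hx
    refine (hW x hx).trans ?_
    calc _ ≤ C₁ * (4 * (b - a) * omegaIntegral (n + 2) g d a b) := by gcongr
      _ = _ := by ring
  refine ⟨fun x hx => (hsup x hx).trans ?_, fun y hy z hz hyz => ?_⟩
  · gcongr
    exact le_max_left _ _
  · set e : ℝ → ℝ := fun y => g y - Q.eval y with he
    have hM' : 0 ≤ C₁ * 4 * (b - a) * omegaIntegral (n + 2) g d a b := by positivity
    refine (abs_sub_le_smoothOmega_one (g := e) hsup hM' hy hz hyz).trans ?_
    refine (H₂ e a b _ d hab hsup hM' hd hdl).trans ?_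
    have : omegaIntegral (n + 2) e d a b = omegaIntegral (n + 2) g d a b := by
      unfold omegaIntegral
      simp only [he, smoothOmega_sub_polynomial hQ]
    rw [this]
    calc _ = C₂ * (1 + C₁ * 4) * d * omegaIntegral (n + 2) g d a b := by field_simp
      _ ≤ _ := by
        gcongr
        exact le_max_right _ _

/-! ### Hermite interpolation by polynomials -/

/-- The monic polynomial whose roots are the entries of `l`. -/
noncomputable def knotPoly (l : List ℝ) : Polynomial ℝ :=
  (l.map fun y => Polynomial.X - Polynomial.C y).prod

lemma knotPoly_eq_multiset (l : List ℝ) :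
    knotPoly l = ((l : Multiset ℝ).map fun y => Polynomial.X - Polynomial.C y).prod := by
  simp [knotPoly]

lemma knotPoly_cons (y : ℝ) (l : List ℝ) :
    knotPoly (y :: l) = (Polynomial.X - Polynomial.C y) * knotPoly l := by
  simp [knotPoly]

lemma knotPoly_monic (l : List ℝ) : (knotPoly l).Monic := by
  rw [knotPoly_eq_multiset]
  exact Polynomial.monic_multiset_prod_of_monic _ _ fun y _ => Polynomial.monic_X_sub_C y

lemma natDegree_knotPoly (l : List ℝ) : (knotPoly l).natDegree = l.length := by
  rw [knotPoly_eq_multiset, Polynomial.natDegree_multiset_prod_X_sub_C_eq_card]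
  simp

lemma coeff_knotPoly_pred {l : List ℝ} {n : ℕ} (hl : l.length = n + 1) :
    (knotPoly l).coeff n = -l.sum := by
  have := Polynomial.multiset_prod_X_sub_C_coeff_card_pred (l : Multiset ℝ) (by simp [hl])
  rw [← knotPoly_eq_multiset] at this
  simpa [hl] using this

lemma rootMultiplicity_knotPoly (l : List ℝ) (y : ℝ) :
    (knotPoly l).rootMultiplicity y = l.count y := by
  rw [← Polynomial.count_roots, knotPoly_eq_multiset, Polynomial.roots_multiset_prod_X_sub_C,
    Multiset.coe_count]

lemma iterate_derivative_knotPoly_eval {l : List ℝ} {y : ℝ} {j : ℕ} (h : j < l.count y) :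
    (Polynomial.derivative^[j] (knotPoly l)).eval y = 0 := by
  rw [← rootMultiplicity_knotPoly,
    Polynomial.lt_rootMultiplicity_iff_isRoot_iterate_derivative (knotPoly_monic l).ne_zero] at h
  exact h j le_rfl

lemma iterate_derivative_knotPoly_eval_ne_zero (l : List ℝ) (y : ℝ) :
    (Polynomial.derivative^[l.count y] (knotPoly l)).eval y ≠ 0 := by
  intro h
  have : l.count y < (knotPoly l).rootMultiplicity y := by
    rw [Polynomial.lt_rootMultiplicity_iff_isRoot_iterate_derivative (knotPoly_monic l).ne_zero]
    intro j hj
    rcases hj.lt_or_eq with hj | rfl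
    · exact iterate_derivative_knotPoly_eval hj
    · exact h
  rw [rootMultiplicity_knotPoly] at this
  exact lt_irrefl _ this

/-- `p` matches the derivative data `F` at the knots of `l`, counted with multiplicity. -/
def Interpolates (F : ℕ → ℝ → ℝ) (p : Polynomial ℝ) (l : List ℝ) : Prop :=
  ∀ y j, j < l.count y → (Polynomial.derivative^[j] p).eval y = F j y

lemma Interpolates.sub_knotPoly {F : ℕ → ℝ → ℝ} {p : Polynomial ℝ} {l l' : List ℝ}
    (h : Interpolates F p l) (hl : ∀ y, l'.count y ≤ l.count y) (c : ℝ) :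
    Interpolates F (p - Polynomial.C c * knotPoly l') l' := by
  intro y j hj
  rw [Polynomial.iterate_derivative_sub, Polynomial.iterate_derivative_C_mul, Polynomial.eval_sub,
    Polynomial.eval_mul, iterate_derivative_knotPoly_eval hj, mul_zero, sub_zero]
  exact h y j (hj.trans_le (hl y))

lemma degree_sub_C_mul_lt {p q : Polynomial ℝ} {n : ℕ} (hp : p.degree < (n + 1 : ℕ))
    (hq : q.Monic) (hqn : q.natDegree = n) :
    (p - Polynomial.C (p.coeff n) * q).degree < n := by
  rw [Polynomial.degree_lt_iff_coeff_zero] at hp ⊢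
  intro k hk
  rw [Polynomial.coeff_sub, Polynomial.coeff_C_mul]
  rcases hk.eq_or_lt with rfl | hk
  · have := hq.coeff_natDegree
    rw [hqn] at this
    rw [this]
    ring
  · rw [hp k hk, Polynomial.coeff_eq_zero_of_natDegree_lt (p := q) (by omega)]
    ring

lemma exists_interpolates (F : ℕ → ℝ → ℝ) (l : List ℝ) :
    ∃ p : Polynomial ℝ, p.degree < l.length ∧ Interpolates F p l := by
  induction l with
  | nil => exact ⟨0, by simp, fun y j hj => by simp at hj⟩
  | cons w l ih =>
    obtain ⟨p, hp, hI⟩ := ih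
    set e := (Polynomial.derivative^[l.count w] (knotPoly l)).eval w with he
    have he0 : e ≠ 0 := iterate_derivative_knotPoly_eval_ne_zero l w
    set c := (F (l.count w) w - (Polynomial.derivative^[l.count w] p).eval w) / e with hc
    refine ⟨p + Polynomial.C c * knotPoly l, ?_, fun y j hj => ?_⟩
    · rw [Polynomial.degree_lt_iff_coeff_zero] at hp ⊢
      intro k hk
      rw [List.length_cons] at hk
      rw [Polynomial.coeff_add, Polynomial.coeff_C_mul, hp k (by omega),
        Polynomial.coeff_eq_zero_of_natDegree_lt (by rw [natDegree_knotPoly]; omega)]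
      ring
    · rw [iterate_map_add, Polynomial.iterate_derivative_C_mul,
        Polynomial.eval_add, Polynomial.eval_mul, Polynomial.eval_C]
      by_cases hjl : j < l.count y
      · rw [iterate_derivative_knotPoly_eval hjl, hI y j hjl]
        ring
      · rw [List.count_cons] at hj
        by_cases hwy : w = y
        · subst hwy
          simp only [beq_self_eq_true, if_true] at hj
          have hj' : j = l.count w := by omega
          subst hj'
          rw [← he, hc, div_mul_cancel₀ _ he0]
          ring
        · simp only [beq_iff_eq, hwy, if_false] at hj
          omega

lemma iterate_derivative_eval_of_degree_lt {p : Polynomial ℝ} {n : ℕ}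
    (hp : p.degree < (n + 1 : ℕ)) (x : ℝ) :
    (Polynomial.derivative^[n] p).eval x = n.factorial * p.coeff n := by
  have h : (Polynomial.derivative^[n] p) = Polynomial.C (n.factorial * p.coeff n) := by
    ext k
    rw [Polynomial.coeff_iterate_derivative, Polynomial.coeff_C]
    split_ifs with hk
    · subst hk
      simp [Nat.descFactorial_self]
    · rw [Polynomial.degree_lt_iff_coeff_zero] at hp
      rw [hp (k + n) (by omega), smul_zero]
  rw [h, Polynomial.eval_C]

theorem divDiff_eq_coeff (F : ℕ → ℝ → ℝ) (l : List ℝ) {p : Polynomial ℝ}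
    (hp : p.degree < l.length) (hI : Interpolates F p l) :
    divDiff F l = p.coeff (l.length - 1) := by
  induction hn : l.length using Nat.strong_induction_on generalizing l p with
  | _ n ih =>
  subst hn
  match l, hp, hI, ih with
  | [], hp, _, _ =>
    have : p = 0 := by simpa using hp
    simp [divDiff, this]
  | [x], hp, hI, _ =>
    have h1 := hI x 0 (by simp)
    have h2 := iterate_derivative_eval_of_degree_lt (n := 0) (by simpa using hp) x
    rw [h1] at h2
    simpa [divDiff] using h2
  | x :: y :: l, hp, hI, ih =>
    rw [divDiff]
    split_ifs with h
    · have hcount : (x :: y :: l).count x = (y :: l).length + 1 := by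
        rw [List.count_cons_self, List.count_eq_length.2 fun z hz => (h z hz).symm]
      have h1 := hI x (y :: l).length (by omega)
      have h2 := iterate_derivative_eval_of_degree_lt (n := (y :: l).length)
        (by simpa using hp) x
      rw [h1] at h2
      rw [h2, mul_div_cancel_left₀ _ (by positivity)]
      simp
    · set q := (y :: l).findIdx (fun z => decide (z ≠ x)) with hq
      have hql : q < (y :: l).length := by
        push Not at h
        obtain ⟨z, hz, hzx⟩ := h
        exact List.findIdx_lt_length_of_exists ⟨z, hz, by simpa using hzx⟩
      have hget : (y :: l)[q] ≠ x := by
        have := List.findIdx_getElem (w := hql)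
        exact of_decide_eq_true this
      have hgetD : (y :: l).getD q 0 = (y :: l)[q] := List.getD_eq_getElem _ _ hql
      have hperm := List.getElem_cons_eraseIdx_perm hql
      have hlen : ((y :: l).eraseIdx q).length = l.length := by
        have := hperm.length_eq
        simpa only [List.length_cons, Nat.add_right_cancel_iff] using this
      have hsum : (y :: l)[q] + ((y :: l).eraseIdx q).sum = (y :: l).sum := by
        simp
      have hp' : p.degree < (l.length + 1 + 1 : ℕ) := by simpa using hp
      have hlen2 : (x :: (y :: l).eraseIdx q).length = l.length + 1 := by simp [hlen]
      set c := p.coeff (l.length + 1)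
      have h1 := ih (y :: l).length (by simp) (y :: l)
        (p := p - Polynomial.C c * knotPoly (y :: l))
        (by
          have := degree_sub_C_mul_lt hp' (knotPoly_monic (y :: l)) (by simp [natDegree_knotPoly])
          simpa using this)
        (hI.sub_knotPoly (fun z => (List.sublist_cons_self _ _).count_le _) c) rfl
      have h2 := ih (x :: (y :: l).eraseIdx q).length (by simp [hlen])
        (x :: (y :: l).eraseIdx q)
        (p := p - Polynomial.C c * knotPoly (x :: (y :: l).eraseIdx q))
        (by
          rw [hlen2]
          exact degree_sub_C_mul_lt hp' (knotPoly_monic _) (by rw [natDegree_knotPoly, hlen2]))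
        (hI.sub_knotPoly (fun z => ((List.eraseIdx_sublist _ _).cons_cons x).count_le _) c) rfl
      rw [h1, h2, hlen2, hgetD, div_eq_iff (sub_ne_zero.2 hget)]
      simp only [List.length_cons, Nat.add_sub_cancel]
      rw [Polynomial.coeff_sub, Polynomial.coeff_sub, Polynomial.coeff_C_mul,
        Polynomial.coeff_C_mul, coeff_knotPoly_pred (n := l.length) (by simp),
        coeff_knotPoly_pred (n := l.length) hlen2, ← hsum, List.sum_cons]
      ring

lemma eval_knotPoly (l : List ℝ) (t : ℝ) :
    (knotPoly l).eval t = ∏ i ∈ Finset.range l.length, (t - l.getD i 0) := by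
  induction l with
  | nil => simp [knotPoly]
  | cons w l ih =>
    rw [knotPoly_cons, Polynomial.eval_mul, ih, List.length_cons, Finset.prod_range_succ']
    simp [mul_comm]

/-- The Newton form evaluates to the Hermite interpolation polynomial. -/
theorem newtonSum_eq_eval (F : ℕ → ℝ → ℝ) (l : List ℝ) (t : ℝ) {p : Polynomial ℝ}
    (hp : p.degree < l.length) (hI : Interpolates F p l) : newtonSum F l t = p.eval t := by
  induction l using List.reverseRecOn generalizing p with
  | nil =>
    have : p = 0 := by simpa using hp
    simp [newtonSum, this]
  | append_singleton l w ih =>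
    have hp' : p.degree < (l.length + 1 : ℕ) := by simpa using hp
    have h1 := ih (p := p - Polynomial.C (p.coeff l.length) * knotPoly l)
      (degree_sub_C_mul_lt hp' (knotPoly_monic l) (natDegree_knotPoly l))
      (hI.sub_knotPoly (fun z => (List.sublist_append_left _ _).count_le _) _)
    have h2 := divDiff_eq_coeff F _ hp hI
    rw [List.length_append, List.length_singleton, Nat.add_sub_cancel] at h2
    rw [Polynomial.eval_sub, Polynomial.eval_mul, Polynomial.eval_C, eval_knotPoly] at h1
    unfold newtonSum at h1 ⊢
    rw [List.length_append, List.length_singleton, Finset.sum_range_succ]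
    have e1 : (l ++ [w]).take (l.length + 1) = l ++ [w] := List.take_of_length_le (by simp)
    rw [e1, h2]
    have e2 : ∀ i < l.length, (l ++ [w]).getD i 0 = l.getD i 0 := fun i hi =>
      List.getD_append _ _ _ _ hi
    have e3 : ∏ i ∈ Finset.range l.length, (t - (l ++ [w]).getD i 0) =
        ∏ i ∈ Finset.range l.length, (t - l.getD i 0) :=
      Finset.prod_congr rfl fun i hi => by rw [e2 i (Finset.mem_range.1 hi)]
    have e4 : ∑ j ∈ Finset.range l.length, divDiff F ((l ++ [w]).take (j + 1)) *
          ∏ i ∈ Finset.range j, (t - (l ++ [w]).getD i 0) =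
        ∑ j ∈ Finset.range l.length, divDiff F (l.take (j + 1)) *
          ∏ i ∈ Finset.range j, (t - l.getD i 0) := by
      refine Finset.sum_congr rfl fun j hj => ?_
      have hj' := Finset.mem_range.1 hj
      rw [List.take_append_of_le_length (by omega)]
      congr 1
      exact Finset.prod_congr rfl fun i hi => by
        rw [e2 i ((Finset.mem_range.1 hi).trans hj')]
    rw [e3, e4, h1]
    ring

/-! ### Rolle's theorem with multiplicities and divided difference bounds -/

lemma exists_zero_of_multiplicity (n : ℕ) {D : ℕ → ℝ → ℝ} {y : ℕ → ℝ} {A B : ℝ}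
    (hD : ∀ j < n, ∀ x ∈ Set.Icc A B, HasDerivWithinAt (D j) (D (j + 1) x) (Set.Icc A B) x)
    (hy : Monotone y) (hA : A ≤ y 0) (hB : y n ≤ B)
    (h0 : ∀ i j, i + j ≤ n → y i = y (i + j) → D j (y i) = 0) :
    ∃ ξ ∈ Set.Icc (y 0) (y n), D n ξ = 0 := by
  induction n generalizing D y with
  | zero => exact ⟨y 0, ⟨le_rfl, le_rfl⟩, h0 0 0 le_rfl rfl⟩
  | succ n ih =>
    have hz : ∀ i, ∃ z, y i ≤ z ∧ z ≤ y (i + 1) ∧ (i ≤ n → D 1 z = 0) ∧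
        (y i = y (i + 1) ∨ (y i < z ∧ z < y (i + 1))) := by
      intro i
      rcases (hy (Nat.le_succ i)).eq_or_lt with he | hlt
      · exact ⟨y i, le_rfl, he.le, fun hi => h0 i 1 (by omega) he, Or.inl he⟩
      by_cases hi : i ≤ n
      · have hsub : Set.Icc (y i) (y (i + 1)) ⊆ Set.Icc A B :=
          Set.Icc_subset_Icc (hA.trans (hy (Nat.zero_le i))) ((hy (by omega)).trans hB)
        obtain ⟨z, hz, hz0⟩ := exists_hasDerivAt_eq_zero (f := D 0) (f' := D 1) hlt
          (fun x hx => ((hD 0 (by omega) x (hsub hx)).continuousWithinAt).mono hsub)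
          ((h0 i 0 (by omega) rfl).trans (h0 (i + 1) 0 (by omega) rfl).symm)
          (fun x hx => (hD 0 (by omega) x (hsub ⟨hx.1.le, hx.2.le⟩)).hasDerivAt
            (Filter.mem_of_superset (Icc_mem_nhds hx.1 hx.2) hsub))
        exact ⟨z, hz.1.le, hz.2.le, fun _ => hz0, Or.inr hz⟩
      · refine ⟨(y i + y (i + 1)) / 2, ?_, ?_, fun h => absurd h hi, Or.inr ⟨?_, ?_⟩⟩ <;>
          simp only [Nat.succ_eq_add_one] at hlt <;> linarith
    choose z hz1 hz2 hz3 hz4 using hz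
    obtain ⟨ξ, hξ, hξ0⟩ := ih (D := fun j => D (j + 1)) (y := z)
      (fun j hj => hD (j + 1) (by omega))
      (monotone_nat_of_le_succ fun i => (hz2 i).trans (hz1 (i + 1)))
      (hA.trans (hz1 0)) ((hz2 n).trans hB)
      (by
        intro i j hij he
        rcases Nat.eq_zero_or_pos j with rfl | hj
        · exact hz3 i (by omega)
        have h1 : z i ≤ y (i + 1) := hz2 i
        have h2 : y (i + 1) ≤ y (i + j) := hy (by omega)
        have h3 : y (i + j) ≤ z (i + j) := hz1 (i + j)
        have h4 : y i = y (i + 1) := by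
          rcases hz4 i with h | h
          · exact h
          · linarith [h.2]
        have h5 : y (i + j) = y (i + j + 1) := by
          rcases hz4 (i + j) with h | h
          · exact h
          · linarith [h.1]
        have h6 : z i = y i := by linarith
        rw [h6]
        refine h0 i (j + 1) (by omega) ?_
        rw [← add_assoc, ← h5]
        linarith)
    exact ⟨ξ, ⟨(hz1 0).trans hξ.1, hξ.2.trans (hz2 n)⟩, hξ0⟩

/-- `p` matches the derivative data `G` at the knots `y i, …, y (i + n)` of a monotone sequence. -/
def InterpolatesOn (G : ℕ → ℝ → ℝ) (p : Polynomial ℝ) (y : ℕ → ℝ) (i n : ℕ) : Prop :=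
  ∀ a b, i ≤ a → a + b ≤ i + n → y a = y (a + b) →
    (Polynomial.derivative^[b] p).eval (y a) = G b (y a)

/-- Mean value theorem for divided differences. -/
lemma exists_coeff_eq {n i : ℕ} {G : ℕ → ℝ → ℝ} {p : Polynomial ℝ} {y : ℕ → ℝ} {A B : ℝ}
    (hG : ∀ j < n, ∀ x ∈ Set.Icc A B, HasDerivWithinAt (G j) (G (j + 1) x) (Set.Icc A B) x)
    (hy : Monotone y) (hA : A ≤ y i) (hB : y (i + n) ≤ B) (hp : p.degree < (n + 1 : ℕ))
    (hI : InterpolatesOn G p y i n) :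
    ∃ ξ ∈ Set.Icc (y i) (y (i + n)), n.factorial * p.coeff n = G n ξ := by
  obtain ⟨ξ, hξ, h⟩ := exists_zero_of_multiplicity n
    (D := fun j x => G j x - (Polynomial.derivative^[j] p).eval x) (y := fun a => y (i + a))
    (A := A) (B := B)
    (fun j hj x hx => by
      have := (Polynomial.derivative^[j] p).hasDerivAt x
      rw [← Function.iterate_succ_apply' (f := Polynomial.derivative)] at this
      exact (hG j hj x hx).sub this.hasDerivWithinAt)
    (fun a b hab => hy (by omega)) hA hB
    (fun a b hab he => sub_eq_zero.2
      (hI (i + a) b (by omega) (by omega) (by rw [add_assoc]; exact he)).symm)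
  refine ⟨ξ, hξ, ?_⟩
  rw [← iterate_derivative_eval_of_degree_lt hp ξ]
  linarith

/-- The monic polynomial with roots `y i, …, y (i + n)`. -/
noncomputable def windowPoly (y : ℕ → ℝ) (i n : ℕ) : Polynomial ℝ :=
  ∏ j ∈ Finset.Icc i (i + n), (Polynomial.X - Polynomial.C (y j))

lemma windowPoly_monic (y : ℕ → ℝ) (i n : ℕ) : (windowPoly y i n).Monic :=
  Polynomial.monic_prod_X_sub_C _ _

lemma natDegree_windowPoly (y : ℕ → ℝ) (i n : ℕ) : (windowPoly y i n).natDegree = n + 1 := by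
  rw [windowPoly, Polynomial.natDegree_finsetProd_X_sub_C_eq_card, Nat.card_Icc]
  omega

lemma coeff_windowPoly (y : ℕ → ℝ) (i n : ℕ) :
    (windowPoly y i n).coeff n = -∑ j ∈ Finset.Icc i (i + n), y j := by
  have := Polynomial.prod_X_sub_C_coeff_card_pred (Finset.Icc i (i + n)) y (by simp)
  rwa [Nat.card_Icc, show i + n + 1 - i - 1 = n by omega] at this

lemma iterate_derivative_windowPoly {y : ℕ → ℝ} (hy : Monotone y) {i n a b : ℕ} (ha : i ≤ a)
    (hab : a + b ≤ i + n) (he : y a = y (a + b)) :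
    (Polynomial.derivative^[b] (windowPoly y i n)).eval (y a) = 0 := by
  have h1 : (Polynomial.X - Polynomial.C (y a)) ^ (b + 1) ∣ windowPoly y i n := by
    have h2 : ∏ j ∈ Finset.Icc a (a + b), (Polynomial.X - Polynomial.C (y j)) =
        (Polynomial.X - Polynomial.C (y a)) ^ (b + 1) := by
      rw [Finset.prod_congr rfl (g := fun _ => Polynomial.X - Polynomial.C (y a)), Finset.prod_const,
        Nat.card_Icc, show a + b + 1 - a = b + 1 by omega]
      intro j hj
      have hj' := Finset.mem_Icc.1 hj
      have : y j = y a := le_antisymm ((hy hj'.2).trans he.ge) (hy hj'.1)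
      rw [this]
    rw [← h2]
    exact Finset.prod_dvd_prod_of_subset _ _ _ (Finset.Icc_subset_Icc ha hab)
  have h3 := Polynomial.pow_sub_dvd_iterate_derivative_of_pow_dvd b h1
  rw [Nat.add_sub_cancel_left, pow_one, Polynomial.dvd_iff_isRoot] at h3
  exact h3

lemma InterpolatesOn.sub_windowPoly {G : ℕ → ℝ → ℝ} {p : Polynomial ℝ} {y : ℕ → ℝ}
    (hy : Monotone y) {i n i' n' : ℕ} (h : InterpolatesOn G p y i n) (hi : i ≤ i')
    (hn : i' + n' ≤ i + n) (c : ℝ) :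
    InterpolatesOn G (p - Polynomial.C c * windowPoly y i' n') y i' n' := by
  intro a b ha hab he
  rw [Polynomial.iterate_derivative_sub, Polynomial.iterate_derivative_C_mul, Polynomial.eval_sub,
    Polynomial.eval_mul, iterate_derivative_windowPoly hy ha hab he, mul_zero, sub_zero]
  exact h a b (hi.trans ha) (hab.trans hn) he

/-- The recursion for divided differences. -/
lemma InterpolatesOn.exists_split {G : ℕ → ℝ → ℝ} {p : Polynomial ℝ} {y : ℕ → ℝ}
    (hy : Monotone y) {i n : ℕ} (hp : p.degree < (n + 1 + 1 : ℕ))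
    (h : InterpolatesOn G p y i (n + 1)) :
    ∃ p₁ p₂ : Polynomial ℝ, p₁.degree < (n + 1 : ℕ) ∧ p₂.degree < (n + 1 : ℕ) ∧
      InterpolatesOn G p₁ y (i + 1) n ∧ InterpolatesOn G p₂ y i n ∧
      p.coeff (n + 1) * (y (i + (n + 1)) - y i) = p₁.coeff n - p₂.coeff n := by
  set c := p.coeff (n + 1)
  refine ⟨p - Polynomial.C c * windowPoly y (i + 1) n, p - Polynomial.C c * windowPoly y i n,
    degree_sub_C_mul_lt hp (windowPoly_monic ..) (natDegree_windowPoly ..),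
    degree_sub_C_mul_lt hp (windowPoly_monic ..) (natDegree_windowPoly ..),
    h.sub_windowPoly hy (by omega) (by omega) c, h.sub_windowPoly hy (by omega) (by omega) c, ?_⟩
  have hs : ∑ j ∈ Finset.Icc (i + 1) (i + 1 + n), y j + y i =
      ∑ j ∈ Finset.Icc i (i + n), y j + y (i + (n + 1)) := by
    rw [show i + 1 + n = i + n + 1 by ring, ← add_assoc i n 1,
      ← Finset.sum_Icc_succ_top (by omega),
      ← Finset.add_sum_Ioc_eq_sum_Icc (a := i) (b := i + n + 1) (by omega), add_comm,
      Finset.Icc_add_one_left_eq_Ioc]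
  rw [Polynomial.coeff_sub, Polynomial.coeff_sub, Polynomial.coeff_C_mul, Polynomial.coeff_C_mul,
    coeff_windowPoly, coeff_windowPoly]
  have : y (i + (n + 1)) - y i = ∑ j ∈ Finset.Icc (i + 1) (i + 1 + n), y j -
      ∑ j ∈ Finset.Icc i (i + n), y j := by linarith
  rw [this]
  ring

lemma abs_coeff_le_of_window {G : ℕ → ℝ → ℝ} {y : ℕ → ℝ} (hy : Monotone y) {n₀ m : ℕ}
    {s K : ℝ} (hs : 0 < s)
    (hspread : ∀ i n, n₀ < n → i + n ≤ m → s ≤ y (i + n) - y i)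
    (hbase : ∀ i (p : Polynomial ℝ), i + n₀ ≤ m → p.degree < (n₀ + 1 : ℕ) →
      InterpolatesOn G p y i n₀ → |p.coeff n₀| ≤ K) (k : ℕ) :
    ∀ i (p : Polynomial ℝ), i + (n₀ + k) ≤ m → p.degree < (n₀ + k + 1 : ℕ) →
      InterpolatesOn G p y i (n₀ + k) → |p.coeff (n₀ + k)| ≤ (2 / s) ^ k * K := by
  induction k with
  | zero => simpa using hbase
  | succ k ih =>
    intro i p hi hp hI
    obtain ⟨p₁, p₂, hd₁, hd₂, hI₁, hI₂, he⟩ := InterpolatesOn.exists_split hy hp hI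
    have h₁ := ih (i + 1) p₁ (by omega) hd₁ hI₁
    have h₂ := ih i p₂ (by omega) hd₂ hI₂
    have h3 := hspread i (n₀ + (k + 1)) (by omega) hi
    have h4 : |p.coeff (n₀ + (k + 1))| * s ≤ 2 * ((2 / s) ^ k * K) := by
      calc _ ≤ |p.coeff (n₀ + (k + 1))| * |y (i + (n₀ + (k + 1))) - y i| := by
            gcongr
            exact h3.trans (le_abs_self _)
        _ = |p₁.coeff (n₀ + k) - p₂.coeff (n₀ + k)| := by
            rw [← abs_mul]
            exact congrArg _ he
        _ ≤ |p₁.coeff (n₀ + k)| + |p₂.coeff (n₀ + k)| := abs_sub _ _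
        _ ≤ _ := by linarith
    rw [← le_div_iff₀ hs] at h4
    refine h4.trans (le_of_eq ?_)
    rw [pow_succ]
    ring

/-! ### Inserting a point into the knot sequence -/

lemma exists_iterate_derivative_eq (r : ℕ) {k : ℕ} {Q : Polynomial ℝ} (hQ : Q.natDegree < k) :
    ∃ P : Polynomial ℝ, Polynomial.derivative^[r] P = Q ∧ P.natDegree < k + r := by
  induction r generalizing k Q with
  | zero => exact ⟨Q, rfl, hQ⟩
  | succ r ih =>
    obtain ⟨R, hR, hRd⟩ : ∃ R : Polynomial ℝ, Polynomial.derivative R = Q ∧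
        R.natDegree < k + 1 := by
      refine ⟨Q.sum fun n c => Polynomial.monomial (n + 1) (c / (n + 1)), ?_, ?_⟩
      · rw [Polynomial.sum, Polynomial.derivative_sum]
        conv_rhs => rw [Q.as_sum_support]
        refine Finset.sum_congr rfl fun n _ => ?_
        rw [Polynomial.derivative_monomial, Nat.add_sub_cancel]
        congr 1
        push_cast
        field_simp
      · refine Nat.lt_succ_of_le (Polynomial.natDegree_sum_le_of_forall_le _ _ fun n hn => ?_)
        exact (Polynomial.natDegree_monomial_le _).trans
          ((Polynomial.le_natDegree_of_mem_supp n hn).trans_lt hQ)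
    obtain ⟨P, hP, hPd⟩ := ih hRd
    exact ⟨P, by rw [Function.iterate_succ_apply', hP, hR], by omega⟩

lemma abs_coeff_le_of_spread {r i : ℕ} {G : ℕ → ℝ → ℝ} {p : Polynomial ℝ} {y : ℕ → ℝ} {A B W : ℝ}
    (hG : ∀ j < r, ∀ x ∈ Set.Icc A B, HasDerivWithinAt (G j) (G (j + 1) x) (Set.Icc A B) x)
    (hy : Monotone y) (hA : A ≤ y i) (hB : y (i + (r + 1)) ≤ B)
    (hp : p.degree < (r + 1 + 1 : ℕ)) (hI : InterpolatesOn G p y i (r + 1))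
    (hs : 0 < y (i + (r + 1)) - y i)
    (hW : ∀ u ∈ Set.Icc (y i) (y (i + (r + 1))), ∀ v ∈ Set.Icc (y i) (y (i + (r + 1))),
      |G r u - G r v| ≤ W * (y (i + (r + 1)) - y i)) :
    |p.coeff (r + 1)| ≤ W := by
  obtain ⟨p₁, p₂, hd₁, hd₂, hI₁, hI₂, he⟩ := InterpolatesOn.exists_split hy hp hI
  have e : i + 1 + r = i + (r + 1) := by ring
  obtain ⟨u, hu, hu'⟩ := exists_coeff_eq hG hy (hA.trans (hy (Nat.le_succ i))) (by rwa [e]) hd₁ hI₁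
  obtain ⟨v, hv, hv'⟩ := exists_coeff_eq hG hy hA ((hy (by omega)).trans hB) hd₂ hI₂
  have h1 := hW u ⟨(hy (Nat.le_succ i)).trans hu.1, by rw [← e]; exact hu.2⟩ v
    ⟨hv.1, hv.2.trans (hy (by omega))⟩
  have h2 : (1 : ℝ) ≤ r.factorial := by exact_mod_cast r.factorial_pos
  rw [← hu', ← hv', ← mul_sub, ← he, abs_mul, abs_mul, abs_of_pos hs,
    abs_of_pos (by linarith : (0 : ℝ) < r.factorial)] at h1
  have h3 : |p.coeff (r + 1)| * (y (i + (r + 1)) - y i) ≤ W * (y (i + (r + 1)) - y i) :=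
    (le_mul_of_one_le_left (by positivity) h2).trans h1
  exact le_of_mul_le_mul_right h3 hs

/-- The sequence `x` with `t` inserted at position `q`. -/
noncomputable def insertKnot (x : ℕ → ℝ) (q : ℕ) (t : ℝ) (i : ℕ) : ℝ :=
  if i < q then x i else if i = q then t else x (i - 1)

lemma insertKnot_of_lt {x : ℕ → ℝ} {q i : ℕ} {t : ℝ} (h : i < q) : insertKnot x q t i = x i :=
  if_pos h

lemma insertKnot_self (x : ℕ → ℝ) (q : ℕ) (t : ℝ) : insertKnot x q t q = t := by
  simp [insertKnot]

lemma insertKnot_of_gt {x : ℕ → ℝ} {q i : ℕ} {t : ℝ} (h : q < i) :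
    insertKnot x q t i = x (i - 1) := by
  rw [insertKnot, if_neg (by omega), if_neg (by omega)]

section InsertKnot

variable {x : ℕ → ℝ} {q : ℕ} {t : ℝ}

lemma insertKnot_le (hx : Monotone x) (hgt : ∀ i, q ≤ i → t < x i) (i : ℕ) :
    insertKnot x q t i ≤ x i := by
  rcases lt_trichotomy i q with h | rfl | h
  · rw [insertKnot_of_lt h]
  · rw [insertKnot_self]
    exact (hgt i le_rfl).le
  · rw [insertKnot_of_gt h]
    exact hx (Nat.sub_le _ _)

lemma le_insertKnot_succ (hx : Monotone x) (hlt : ∀ i < q, x i < t) (i : ℕ) :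
    x i ≤ insertKnot x q t (i + 1) := by
  rcases lt_trichotomy (i + 1) q with h | rfl | h
  · rw [insertKnot_of_lt h]
    exact hx (Nat.le_succ i)
  · rw [insertKnot_self]
    exact (hlt i (Nat.lt_succ_self i)).le
  · rw [insertKnot_of_gt h, Nat.add_sub_cancel]

lemma monotone_insertKnot (hx : Monotone x) (hlt : ∀ i < q, x i < t)
    (hgt : ∀ i, q ≤ i → t < x i) : Monotone (insertKnot x q t) :=
  monotone_nat_of_le_succ fun i =>
    (insertKnot_le hx hgt i).trans (le_insertKnot_succ hx hlt i)

lemma lt_count_ofFn {m a b : ℕ} (hx : Monotone x) (hab : a + b < m) (he : x a = x (a + b)) :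
    b < (List.ofFn fun i : Fin m => x i).count (x a) := by
  have h1 : List.replicate (b + 1) (x a) = (List.range' a (b + 1)).map x := by
    symm
    rw [List.eq_replicate_iff]
    refine ⟨by simp, fun z hz => ?_⟩
    obtain ⟨j, hj, rfl⟩ := List.mem_map.1 hz
    rw [List.mem_range'_1] at hj
    exact le_antisymm ((hx (by omega)).trans he.ge) (hx hj.1)
  have h2 : (List.ofFn fun i : Fin m => x i) = (List.range m).map x := by
    rw [List.ofFn_eq_map, ← List.map_coe_finRange_eq_range, List.map_map]
    rfl
  have h3 : (List.range' a (b + 1)).Sublist (List.range m) := by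
    have e : List.range m = List.range' 0 a ++
        (List.range' a (b + 1) ++ List.range' (a + (b + 1)) (m - (a + (b + 1)))) := by
      have h := List.range'_append_1 (s := 0) (m := a) (n := m - a)
      rw [zero_add] at h
      rw [List.range'_append_1, show b + 1 + (m - (a + (b + 1))) = m - a by omega, h,
        List.range_eq_range', Nat.add_sub_cancel' (by omega)]
    rw [e]
    exact (List.sublist_append_left _ _).trans (List.sublist_append_right _ _)
  rw [h2, Nat.lt_iff_add_one_le, ← List.replicate_sublist_iff, h1]
  exact h3.map x

lemma Interpolates.interpolatesOn_insertKnot {F : ℕ → ℝ → ℝ} {p : Polynomial ℝ} {m : ℕ}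
    (hx : Monotone x) (hlt : ∀ i < q, x i < t) (hgt : ∀ i, q ≤ i → t < x i)
    (hq : q ≤ m) (h : Interpolates F p (t :: List.ofFn fun i : Fin m => x i)) :
    InterpolatesOn F p (insertKnot x q t) 0 m := by
  intro a b _ hab he
  refine h _ _ ?_
  have key : ∀ a, a + b < m → x a = x (a + b) →
      b < (t :: List.ofFn fun i : Fin m => x i).count (x a) := fun a hab he =>
    (lt_count_ofFn hx hab he).trans_le ((List.sublist_cons_self _ _).count_le _)
  rcases lt_trichotomy a q with ha | rfl | ha
  · rw [insertKnot_of_lt ha] at he ⊢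
    have hb : a + b < q := by
      by_contra hb
      rcases (not_lt.1 hb).eq_or_lt with hb | hb
      · rw [← hb, insertKnot_self] at he
        exact (hlt a ha).ne he
      · rw [insertKnot_of_gt hb] at he
        linarith [hlt a ha, hgt (a + b - 1) (by omega)]
    rw [insertKnot_of_lt hb] at he
    exact key a (hb.trans_le hq) he
  · rw [insertKnot_self] at he ⊢
    have hb : b = 0 := by
      by_contra hb
      rw [insertKnot_of_gt (by omega)] at he
      linarith [hgt (a + b - 1) (by omega)]
    simp [hb]
  · rw [insertKnot_of_gt ha] at he ⊢
    rw [insertKnot_of_gt (by omega), show a + b - 1 = a - 1 + b by omega] at he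
    exact key (a - 1) (by omega) he

end InsertKnot

lemma le_insertKnot_spread {x : ℕ → ℝ} {q r i m : ℕ} {t s d : ℝ} (hx : Monotone x)
    (hlt : ∀ i < q, x i < t) (hgt : ∀ i, q ≤ i → t < x i) (hq : q ≤ m) (hi : i + r ≤ m)
    (hs : ∀ j, j + r + 1 ≤ m → s ≤ x (j + r + 1) - x j)
    (hd : ∃ j, i ≤ j ∧ j ≤ i + r ∧ d ≤ |t - x j|) :
    s ≤ insertKnot x q t (i + (r + 1)) - insertKnot x q t i ∨
      d ≤ insertKnot x q t (i + (r + 1)) - insertKnot x q t i := by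
  have hy := monotone_insertKnot hx hlt hgt
  rcases Nat.lt_or_ge (i + (r + 1)) q with h | h
  · left
    rw [insertKnot_of_lt h, insertKnot_of_lt (by omega)]
    exact hs i (by omega)
  rcases Nat.lt_or_ge q i with h' | h'
  · left
    rw [insertKnot_of_gt h', insertKnot_of_gt (by omega)]
    have := hs (i - 1) (by omega)
    rwa [show i - 1 + r + 1 = i + (r + 1) - 1 by omega] at this
  · right
    obtain ⟨j, hij, hjr, hj⟩ := hd
    have h1 : insertKnot x q t i ≤ t := (hy h').trans (insertKnot_self x q t).le
    have h2 : t ≤ insertKnot x q t (i + (r + 1)) :=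
      (insertKnot_self x q t).ge.trans (hy h)
    have h3 := (insertKnot_le hx hgt i).trans (hx hij)
    have h4 := (hx hjr).trans (le_insertKnot_succ hx hlt (i + r))
    refine hj.trans (abs_le.2 ⟨?_, ?_⟩) <;> rw [← add_assoc] at * <;> linarith

/-- Bound for the divided difference at the knots `x 0, …, x (n + r + 1)` and one more point. -/
theorem exists_abs_coeff_le (r n : ℕ) {lam : ℝ} (hlam : 0 < lam) :
    ∃ C : ℝ, 0 < C ∧ ∀ (x : ℕ → ℝ) (F : ℕ → ℝ → ℝ) (a b t d : ℝ) (q : ℕ) (p : Polynomial ℝ),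
      Monotone x → a = x 0 → b = x (n + r + 1) → a < b →
      (∀ j, j + r + 1 ≤ n + r + 1 → lam * (b - a) ≤ x (j + r + 1) - x j) →
      (∀ j < r, ∀ u ∈ Set.Icc a b, HasDerivWithinAt (F j) (F (j + 1) u) (Set.Icc a b) u) →
      ContinuousOn (F r) (Set.Icc a b) →
      (∀ i < q, x i < t) → (∀ i, q ≤ i → t < x i) → q ≤ n + r + 1 → t ∈ Set.Icc a b →
      0 < d → d ≤ b - a →
      (∀ i, i + r ≤ n + r + 1 → ∃ j, i ≤ j ∧ j ≤ i + r ∧ d ≤ |t - x j|) →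
      p.degree < (n + r + 2 + 1 : ℕ) →
      Interpolates F p (t :: List.ofFn fun i : Fin (n + r + 2) => x i) →
      |p.coeff (n + r + 2)| * (b - a) ^ (n + 1) ≤ C * omegaIntegral (n + 2) (F r) d a b := by
  obtain ⟨C, hC, H⟩ := exists_polynomial_approx n
  refine ⟨(2 / lam) ^ (n + 1) * (C + 2 * C / lam), by positivity, ?_⟩
  intro x F a b t d q p hx ha hb hab hs hF hFr hlt hgt hq ht hd hdl hpig hp hI
  have hl : 0 < b - a := by linarith
  obtain ⟨M, hM⟩ := isCompact_Icc.exists_bound_of_continuousOn hFr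
  simp only [Real.norm_eq_abs] at hM
  have hM0 : 0 ≤ M := (abs_nonneg _).trans (hM a ⟨le_rfl, hab.le⟩)
  obtain ⟨Q, hQ, hQa⟩ := H (F r) a b hab hFr
  obtain ⟨P, hPQ, hP⟩ := exists_iterate_derivative_eq r hQ
  set J := omegaIntegral (n + 2) (F r) d a b with hJ
  have hJ0 : 0 ≤ J := omegaIntegral_nonneg ..
  set y := insertKnot x q t with hy'
  have hy : Monotone y := monotone_insertKnot hx hlt hgt
  set G : ℕ → ℝ → ℝ := fun j u => F j u - (Polynomial.derivative^[j] P).eval u with hG'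
  have hG : ∀ j < r, ∀ u ∈ Set.Icc a b,
      HasDerivWithinAt (G j) (G (j + 1) u) (Set.Icc a b) u := fun j hj u hu => by
    have := (Polynomial.derivative^[j] P).hasDerivAt u
    rw [← Function.iterate_succ_apply' (f := Polynomial.derivative)] at this
    exact (hF j hj u hu).sub this.hasDerivWithinAt
  have hI' : InterpolatesOn G (p - P) y 0 (n + r + 2) := by
    intro i j hi hij he
    rw [Polynomial.iterate_derivative_sub, Polynomial.eval_sub,
      hI.interpolatesOn_insertKnot hx hlt hgt (by omega) i j hi hij he]
  have hPc : ∀ k, n + r + 2 ≤ k → P.coeff k = 0 := fun k hk =>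
    Polynomial.coeff_eq_zero_of_natDegree_lt (by omega)
  have hp' : (p - P).degree < (n + r + 2 + 1 : ℕ) := by
    rw [Polynomial.degree_lt_iff_coeff_zero] at hp ⊢
    intro k hk
    rw [Polynomial.coeff_sub, hp k hk, hPc k (by omega), sub_zero]
  have hcoeff : (p - P).coeff (n + r + 2) = p.coeff (n + r + 2) := by
    rw [Polynomial.coeff_sub, hPc _ le_rfl, sub_zero]
  have hya : ∀ i, a ≤ y i := fun i => by
    refine le_trans ?_ (hy (Nat.zero_le i))
    rcases Nat.eq_zero_or_pos q with rfl | h0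
    · rw [hy', insertKnot_self]
      exact ht.1
    · rw [hy', insertKnot_of_lt h0, ha]
  have hyb : ∀ i, i ≤ n + r + 2 → y i ≤ b := fun i hi => by
    refine (hy hi).trans ?_
    rw [hy', insertKnot_of_gt (by omega), hb]
    exact hx (by omega)
  have hbase : ∀ i (p : Polynomial ℝ), i + (r + 1) ≤ n + r + 2 → p.degree < (r + 1 + 1 : ℕ) →
      InterpolatesOn G p y i (r + 1) → |p.coeff (r + 1)| ≤ (C + 2 * C / lam) * J := by
    intro i p hi hp hI
    have hiA := hya i
    have hiB := hyb (i + (r + 1)) hi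
    have hGr : ∀ u, G r u = F r u - Q.eval u := fun u => by rw [hG', ← hPQ]
    have key : 0 < y (i + (r + 1)) - y i ∧ ∀ u ∈ Set.Icc (y i) (y (i + (r + 1))),
        ∀ v ∈ Set.Icc (y i) (y (i + (r + 1))),
        |G r u - G r v| ≤ (C + 2 * C / lam) * J * (y (i + (r + 1)) - y i) := by
      rcases le_insertKnot_spread hx hlt hgt hq (by omega : i + r ≤ n + r + 1) hs
        (hpig i (by omega)) with h | h
      · have hpos : 0 < y (i + (r + 1)) - y i := lt_of_lt_of_le (by positivity) h
        refine ⟨hpos, fun u hu v hv => ?_⟩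
        have h1 := (hQa d hd hdl).1 u ⟨hiA.trans hu.1, hu.2.trans hiB⟩
        have h2 := (hQa d hd hdl).1 v ⟨hiA.trans hv.1, hv.2.trans hiB⟩
        rw [hGr, hGr]
        calc _ ≤ |F r u - Q.eval u| + |F r v - Q.eval v| := abs_sub _ _
          _ ≤ 2 * C / lam * J * (lam * (b - a)) := by
            rw [show 2 * C / lam * J * (lam * (b - a)) = 2 * (C * (b - a) * J) by field_simp]
            linarith
          _ ≤ (C + 2 * C / lam) * J * (y (i + (r + 1)) - y i) := by
            gcongr
            linarith
      · refine ⟨hd.trans_le h, fun u hu v hv => ?_⟩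
        have hpos := hd.trans_le h
        have h1 := (hQa _ hpos (by linarith)).2 u ⟨hiA.trans hu.1, hu.2.trans hiB⟩ v
          ⟨hiA.trans hv.1, hv.2.trans hiB⟩
          (abs_le.2 ⟨by linarith [hu.1, hv.2], by linarith [hu.2, hv.1]⟩)
        rw [hGr, hGr]
        refine h1.trans ?_
        have h2 := omegaIntegral_anti hM hM0 hd h (n + 2)
        have h3 : 0 ≤ 2 * C / lam := by positivity
        calc _ ≤ C * (y (i + (r + 1)) - y i) * J := by gcongr
          _ = C * J * (y (i + (r + 1)) - y i) := by ring
          _ ≤ _ := by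
            gcongr
            linarith
    exact abs_coeff_le_of_spread hG hy hiA hiB hp hI key.1 key.2
  have hmain := abs_coeff_le_of_window (m := n + r + 2) (n₀ := r + 1) hy
    (by positivity : 0 < lam * (b - a))
    (fun i k hk hik => by
      have h1 := hs i (by omega)
      have h2 := insertKnot_le (q := q) (t := t) hx hgt i
      have h3 := (hx (by omega : i + r + 1 ≤ i + k - 1)).trans (le_insertKnot_succ hx hlt (i + k - 1))
      rw [show i + k - 1 + 1 = i + k by omega] at h3
      linarith) hbase (n + 1) 0 (p - P) (by omega)
    (by rwa [show r + 1 + (n + 1) + 1 = n + r + 2 + 1 by omega])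
    (by rwa [show r + 1 + (n + 1) = n + r + 2 by omega])
  rw [show r + 1 + (n + 1) = n + r + 2 by omega, hcoeff] at hmain
  calc _ ≤ (2 / (lam * (b - a))) ^ (n + 1) * ((C + 2 * C / lam) * J) * (b - a) ^ (n + 1) := by gcongr
    _ = (2 / lam) ^ (n + 1) * (C + 2 * C / lam) * J := by
      rw [← div_div, div_pow _ (b - a)]
      field_simp

/-! ### The interpolation error -/

lemma exists_interpolation_error (F : ℕ → ℝ → ℝ) (x : ℕ → ℝ) (m : ℕ) (t : ℝ) :
    ∃ p : Polynomial ℝ, p.degree < (m + 1 : ℕ) ∧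
      Interpolates F p (t :: List.ofFn fun i : Fin m => x i) ∧
      |F 0 t - newtonSum F (List.ofFn fun i : Fin m => x i) t| =
        |p.coeff m| * ∏ i : Fin m, |t - x i| := by
  obtain ⟨p, hp, hI⟩ := exists_interpolates F (t :: List.ofFn fun i : Fin m => x i)
  have hp' : p.degree < (m + 1 : ℕ) := by simpa using hp
  refine ⟨p, hp', hI, ?_⟩
  set l := List.ofFn fun i : Fin m => x i with hl
  have hlen : l.length = m := by simp [hl]
  have h1 := newtonSum_eq_eval F l t (p := p - Polynomial.C (p.coeff m) * knotPoly l)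
    (by
      rw [hlen]
      exact degree_sub_C_mul_lt hp' (knotPoly_monic l) (by rw [natDegree_knotPoly, hlen]))
    (hI.sub_knotPoly (fun z => (List.sublist_cons_self _ _).count_le _) _)
  have h2 : p.eval t = F 0 t := hI t 0 (by simp)
  rw [h1, Polynomial.eval_sub, h2, sub_sub_cancel, Polynomial.eval_mul, Polynomial.eval_C, abs_mul,
    knotPoly, Polynomial.eval_list_prod, hl, List.map_map, List.map_ofFn, List.prod_ofFn,
    Finset.abs_prod]
  simp

lemma prod_abs_sub_le {m r : ℕ} (hr : r + 1 ≤ m) {x : ℕ → ℝ} {t L : ℝ} {σ : Fin m → Fin m}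
    (hσ : Function.Bijective σ) (hL : ∀ i : Fin m, |t - x i| ≤ L) :
    ∏ i : Fin m, |t - x i| ≤
      (∏ i ∈ Finset.univ.filter (fun i : Fin m => (i : ℕ) ≤ r), |t - x (σ i)|) *
        L ^ (m - (r + 1)) := by
  rw [← hσ.prod_comp fun i => |t - x i|,
    ← Finset.prod_filter_mul_prod_filter_not Finset.univ (fun i : Fin m => (i : ℕ) ≤ r)]
  refine mul_le_mul_of_nonneg_left ?_ (Finset.prod_nonneg fun _ _ => abs_nonneg _)
  refine (Finset.prod_le_prod (fun _ _ => abs_nonneg _) fun i _ => hL (σ i)).trans (le_of_eq ?_)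
  rw [Finset.prod_const]
  congr 1
  have h1 := Finset.card_filter_add_card_filter_not (s := (Finset.univ : Finset (Fin m)))
    (fun i : Fin m => (i : ℕ) ≤ r)
  have h2 : (Finset.univ.filter fun i : Fin m => (i : ℕ) ≤ r) = Finset.Iic ⟨r, hr⟩ := by
    ext i
    simp [Fin.le_def]
  rw [h2, Fin.card_Iic, Finset.card_univ, Fintype.card_fin] at h1
  simp only [h2] at *
  omega

lemma exists_dist_ge {m r : ℕ} (hr : r < m) {x : ℕ → ℝ} {t : ℝ} {σ : Fin m → Fin m}
    (hσ : Function.Bijective σ)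
    (hord : ∀ i j : Fin m, i ≤ j → |t - x (σ i)| ≤ |t - x (σ j)|) {i : ℕ} (hi : i + r < m) :
    ∃ j, i ≤ j ∧ j ≤ i + r ∧ |t - x (σ ⟨r, hr⟩)| ≤ |t - x j| := by
  by_contra! hcon
  have h1 : ∀ j ∈ Finset.Icc (⟨i, by omega⟩ : Fin m) ⟨i + r, hi⟩,
      j ∈ (Finset.Iio (⟨r, hr⟩ : Fin m)).image σ := by
    intro j hj
    rw [Finset.mem_Icc] at hj
    obtain ⟨k, rfl⟩ := hσ.2 j
    refine Finset.mem_image_of_mem σ (Finset.mem_Iio.2 (lt_of_not_ge fun hk => ?_))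
    exact absurd (hord _ _ hk) (not_le.2 (hcon _ hj.1 hj.2))
  have h2 := (Finset.card_le_card (fun j hj => h1 j hj)).trans Finset.card_image_le
  rw [Fin.card_Icc, Fin.card_Iio] at h2
  simp only at h2
  omega

/-- pointwise Hermite interpolation estimate (Theorem 5.3). -/
theorem stmt16 (r m : ℕ) (hm : r + 2 ≤ m) (lam : ℝ) (hlam0 : 0 < lam) (hlam1 : lam ≤ 1) :
    ∃ C : ℝ, 0 < C ∧ ∀ x : ℕ → ℝ,
      (∀ i j : ℕ, i ≤ j → j ≤ m - 1 → x i ≤ x j) →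
      (∀ j : ℕ, j + r + 1 ≤ m - 1 → lam * (x (m - 1) - x 0) ≤ x (j + r + 1) - x j) →
      x 0 < x (m - 1) →
      ∀ f : ℝ → ℝ, ContDiffOn ℝ r f (Set.Icc (x 0) (x (m - 1))) →
      ∀ t ∈ Set.Icc (x 0) (x (m - 1)), ∀ σ : Fin m → Fin m, Function.Bijective σ →
        (∀ i j : Fin m, i ≤ j → |t - x (σ i)| ≤ |t - x (σ j)|) →
        |f t - newtonSum (fun j => iteratedDerivWithin j f (Set.Icc (x 0) (x (m - 1))))
            (List.ofFn fun i : Fin m => x i) t| ≤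
          C * (∏ i ∈ Finset.univ.filter (fun i : Fin m => (i : ℕ) ≤ r), |t - x (σ i)|) *
            ∫ s in Set.Ioc (|t - x (σ ⟨r, by omega⟩)|) (2 * (x (m - 1) - x 0)),
              smoothOmega (m - r) (iteratedDerivWithin r f (Set.Icc (x 0) (x (m - 1))))
                s (x 0) (x (m - 1)) / s ^ 2 := by
  obtain ⟨n, rfl⟩ : ∃ n, m = n + r + 2 := ⟨m - (r + 2), by omega⟩
  obtain ⟨C, hC, H⟩ := exists_abs_coeff_le r n hlam0
  refine ⟨C, hC, ?_⟩
  intro x hmono hspread hab f hf t ht σ hσ hord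
  simp only [show n + r + 2 - 1 = n + r + 1 by omega, show n + r + 2 - r = n + 2 by omega] at *
  set I := Set.Icc (x 0) (x (n + r + 1)) with hIdef
  set F : ℕ → ℝ → ℝ := fun j => iteratedDerivWithin j f I with hFdef
  set δ := |t - x (σ ⟨r, by omega⟩)| with hδ
  set D := ∏ i ∈ Finset.univ.filter (fun i : Fin (n + r + 2) => (i : ℕ) ≤ r), |t - x (σ i)|
    with hD
  have hl : 0 < x (n + r + 1) - x 0 := by linarith
  have hD0 : 0 ≤ D := Finset.prod_nonneg fun _ _ => abs_nonneg _
  have hF0 : F 0 t = f t := by simp [hFdef]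
  have hUD : UniqueDiffOn ℝ I := uniqueDiffOn_Icc hab
  have hF : ∀ j < r, ∀ u ∈ I, HasDerivWithinAt (F j) (F (j + 1) u) I u := fun j hj u hu => by
    have := (hf.differentiableOn_iteratedDerivWithin (m := j) (by exact_mod_cast hj) hUD u
      hu).hasDerivWithinAt
    rwa [← iteratedDerivWithin_succ] at this
  have hFr : ContinuousOn (F r) I := hf.continuousOn_iteratedDerivWithin le_rfl hUD
  have hL : ∀ i : Fin (n + r + 2), |t - x i| ≤ x (n + r + 1) - x 0 := fun i => by
    have h1 := hmono 0 i (by omega) (by omega)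
    have h2 := hmono i (n + r + 1) (by omega) le_rfl
    exact abs_le.2 ⟨by linarith [ht.1], by linarith [ht.2]⟩
  obtain ⟨p, hp, hI, herr⟩ := exists_interpolation_error F x (n + r + 2) t
  rw [← hF0, herr]
  by_cases hknot : ∃ i : Fin (n + r + 2), t = x i
  · obtain ⟨i, hi⟩ := hknot
    rw [Finset.prod_eq_zero (Finset.mem_univ i) (by rw [hi, sub_self, abs_zero]), mul_zero]
    exact mul_nonneg (by positivity) (omegaIntegral_nonneg (n + 2) (F r) δ _ _)
  · push Not at hknot
    set z : ℕ → ℝ := fun i => x (min i (n + r + 1)) with hz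
    have hzx : ∀ i, i ≤ n + r + 1 → z i = x i := fun i hi => by simp [hz, hi]
    have hzm : Monotone z := fun i j hij => hmono _ _ (by omega) (by omega)
    have hzt : ∀ i, t ≠ z i := fun i => hknot ⟨min i (n + r + 1), by omega⟩
    have hex : ∃ i, t < z i := ⟨n + r + 1,
      lt_of_le_of_ne (by rw [hzx _ le_rfl]; exact ht.2) (hzt _)⟩
    classical
    have hlist : (List.ofFn fun i : Fin (n + r + 2) => x i) =
        List.ofFn fun i : Fin (n + r + 2) => z i := by
      congr 1
      ext i
      exact (hzx _ (by omega)).symm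
    rw [hlist] at hI
    have hδ0 : 0 < δ := abs_pos.2 (sub_ne_zero.2 (hknot _))
    have hmain := H z F (x 0) (x (n + r + 1)) t δ (Nat.find hex) p hzm (hzx _ (by omega)).symm
      (hzx _ le_rfl).symm hab
      (fun j hj => by
        rw [hzx _ hj, hzx _ (by omega)]
        exact hspread j hj)
      hF hFr (fun i hi => lt_of_le_of_ne (not_lt.1 (Nat.find_min hex hi)) (hzt i).symm)
      (fun i hi => (Nat.find_spec hex).trans_le (hzm hi))
      (Nat.find_min' hex (lt_of_le_of_ne (by rw [hzx _ le_rfl]; exact ht.2) (hzt _))) ht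
      hδ0 (hL _)
      (fun i hi => by
        obtain ⟨j, h1, h2, h3⟩ :=
          exists_dist_ge (m := n + r + 2) (r := r) (by omega) hσ hord (i := i) (by omega)
        exact ⟨j, h1, h2, by rwa [hzx _ (by omega)]⟩) hp hI
    have hprod := prod_abs_sub_le (r := r) (by omega) hσ hL
    rw [show n + r + 2 - (r + 1) = n + 1 by omega] at hprod
    calc _ ≤ |p.coeff (n + r + 2)| * (D * (x (n + r + 1) - x 0) ^ (n + 1)) := by gcongr
      _ = |p.coeff (n + r + 2)| * (x (n + r + 1) - x 0) ^ (n + 1) * D := by ring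
      _ ≤ C * omegaIntegral (n + 2) (F r) δ (x 0) (x (n + r + 1)) * D := by gcongr
      _ = C * D * omegaIntegral (n + 2) (F r) δ (x 0) (x (n + r + 1)) := by ring
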